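/- Let c be a negative integer and suppose that c = L_n − 2^x·3^y = L_{n₁} − 2^{x₁}·3^{y₁} = L_{n₂} − 2^{x₂}·3^{y₂} for nonnegative integers with n > n₁ > n₂, n > 500, and n₁ ≤ 500. Then n < 1557, x < 1118, and y < 706. -/

import Mathlib

/-- The Lucas sequence: L 0 = 2, L 1 = 1, L (n+2) = L (n+1) + L n. -/
def lucas : ℕ → ℤ
  | 0 => 2
  | 1 => 1
  | n + 2 => lucas (n + 1) + lucas n

/-- Rows `(m, r, s, mask)` where `2 ^ r ≡ 3 ^ s ≡ 1` modulo `m`, and where every residue of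
`± (2 ^ a - 3 ^ b)` modulo `m` is a set bit of `mask`. -/
def powDiffSieves : List (ℕ × ℕ × ℕ × ℕ) :=
  [(4745, 36, 12, 2241119434522958874799583074594409995286797252053604157595544542721718357033358593371019242045635591760074866436600427749318488008110433014957300630799631901845860050390733797014705303035435785664784080375261529188029910761673919126145515559829127480653077035940231889904532506209150007005647262826104224438984753909422955423805412739897976537754854583586311175939289781444072549393082800040008320166706163733476995863154469798136758274772702119272694708916694370608230628929697240746099006166825875781705025872008883047924435556228955423027541767914547853770618418705987406592411048694355526937223602356928853445817770377588021071639473750809062630343454595853634818456813650253205712459374863572592137662705414687732796120154085533479915271193097043377315960367571279405973199639314352368219808865801956065804183058006600270897532185376450530295201655813861492585948252069585956276124817611518409207669036534119634871453969704374372298585871958872354923586795879489916331068170399867019773279060659815383750717725171291579478990062499815218341632333035728081262927293991483976586146942365855970500268722689771421106017203980078087703733089662135348844065350059218081058792878459472904360884052561113646410138067030267000397747129195893756619945015916658359869236983486314319159623877331734569358715790021332907457926105067219087447426614499931875165672798918796376012185865810392906102766222444092722302896754534137471131363759),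
   (4921, 36, 18, 229945753017487962902657168307945359188603749501056070417209462953021298058281824388536957986104639770406977277670363824713502278192870828029770870870842494124767623936128552236730412761820994533166725516279281418577247237398134855075530867969617721068887685869300575493667176919948101603815693072690893691400386718993442448872641575136757643323634890226244630213314697081241015618953181683253151103699505439790668451572422417846191256837160587836225003067079724256565793515739251583947299118254935367022519794017033280258510427834118841384386689065106608413946390793731986149528721848725315015644896443327457827698048182811882922599676521329116868270100157797049507690413981348986919013749655483262494881049361491641429731998188828137216389167273846039328751979644700198644427508246597301888450848502029955170802084736742884032409532915141255376508947881837903419872649146969444849317351318675604426700337529061949088543153720154386240066831397619543289821446964313811342054316863327430927569866014058827843665553154897509143865929567150483842051503226306797691800063410812163591939587080256765288465998401277476414121784046195473814270287682860700355546080093126398832644149320779402645016402993236578822617488759193692430576535796133790348734591740435907462089181186995769503536320645439016154926279378088083019317930175210965709020519276604233738493561033222008027825089607176032593165612315343718482957235933450518432311267245195671744833391561780579805126189717445732008112063),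
   (3485, 40, 16, 112893926948200746207493085358707385460098699277167502961736081344768706173355279405221509888337538951404003384408302303571264825093902867189952042833695320467531286756865056772511868620140038295058431818954378604183338930805899109952179937967163714797645113500180169347519412803540710722207204977053439879802823030895838440809942139830244888663346592395856893269497104793039537970955048900303551185185438739804989176735598046312553385863391312919595268958484732533820220466899106424586339177907433954820238085058139198575489543844297303948757889831061373588681343068773882853300836448339838471259410604004642306790294573579218914902962527069808679391783561665948196691995767377024724316765940352766617397736675326588912576309873558624250595772530390969909606059350141971770969754483070212006300616567568059392607443369937512541631407817319239946867247721840899528276399201155884123544004053412927101727357897374805536196454003658516363230286115673828675885086833669858414696770173556817481503643930380355846503689027750816530294513729805174572755375),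
   (3367, 36, 18, 339727714356197772872195390353924970805033212736745489770165256466298493690387479416921171243747650665157397689984073180900208536544245581471619612040770557095852477515252254797717208186021647458152732955815736094081740862274745202266221789947127634520862594074469210259618671189847069457571422211312071755545283339637739110228984344160478564647414687210383592371404151210299057801541971047659384162454492994872522630694972020926927336722660450049588919734521579355451755769454913225743540358562206230934669149231878486514148963573693125907139626874833816547192088728824776339324236897024559779118161815328787642679106900869931899617190122549942418169779141224930108422145510740944417069858295004209070651535832978657757784212265679809077822714922148780836548801284163841097889188144600709882681591785372385190825696352134251604305307220417440476586114393203987359454918053032780419657428992165247149215905900365026237941570591567830085330256892649339984539724937131228751152067185232115620263047175856217519729071),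
   (2555, 36, 12, 12465132391606607298455083642579419033972045620690498901048160605975528865423883781184642043203500531515307910542309709098942717916862351464457940237583837694262530306701591468931226090809461291397849818068950507181366019280712630963337390920098712532890774071666242014161470042641839850644846431805762158050620137085552439058732831774584835342285740928402760887105280696966953823860296827020782147546375512298956363152863945552435434508910387653311725875834809246942033607714634456911076514248411019056574573277871621662907045601005297206594014334560491331942116161997761844717575539715854506722957298938062479669984023835086707782867989573977012902524962857564722638364603729376231756201369796765807952166341480910405334791952854350077143311536375061340866703725865903),
   (4433, 60, 30, 2731744894920774834207381575164250182893024474079127016754980865340395194123084180844892072742433156324111526624670652278604600626573567477909560550722661786069666700672787726942919595099870736869272919465201582872406887200452061320073763843316514792966732391997339428761661798792358458927295512018024360386615534295672958856101619314754554950337071940470309134202005215693094546756703073874174347190460128266956724784101455611876334381985996972116653171328315719476293512766391405589291050434017799040803157283962275029918384522069843883692952386788061127965563399903900098446901873588997166078473287339324699620925631583826160093974271125261736608505411578075891902874167079529948012494641833506722205017960148126421611787216600081633353158054214985106452261905670267166750358252500042529579534578872243604262920546077503026622692969694934510708714333524679306823980101776556511434198942431947950311006385651412205607883164593747400638505295392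05120310592473481872537976836199050219483629297200643737811988607597214025286738368422542797119069134106185342924510299517951694801039100377416507546626591621586443189905734464799740271661296755367727706529684577597145462906207784474230796428555427948364480267325757661724250288542261559255511867879435225372359976276443032342781815799445952796121291742668821122977804757204145132031420911),
   (3281, 96, 16, 4779499580752193327669654431888154947451590198670815038899673382896536273566087796491909865998907552724286229436323124505197626059382261840647488784397993140042759459876644984750332502432276689237549425171252251305325514839453184072121370923916941838600476494817202308304313212490602854264745835869483541890336474809561619866118087714146897207243415542720116362684601360802526485199775931411988028841655438054733888947428233390815606901246959864156986144535138978222184439008459766415904241728650469291141630582708352930536334167490399402849805110417477025241734521138454314984011173542086473961193740516282218396115921511838734488031005413555294290374706401282938324161821195600387271944356417394593994195854923090819085214024196934877120771629901912147224734311731606175066141622627771678109283267184213548267783327482997114484199011019085722391533536458932748489888081168794360721954672019358050332857168945416642571189027345337044437301755162444227005088522641014233061780996799512575),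
   (4697, 60, 30, 8108229703935438187876490416820490116110952058738570007196511682585526055571419422861993305068236813018356960585229618282351311091997377185017743640448244900312822538716551500252276675467763017014119352137928988097850830604983301778402340310557058708586438981474246220851869123693114016954381813685528815818196662072247945628425485072787177619523748281753855016597250344952338848674316575761788821454418119938736782703070514693719403847093621686957861533111717343349532010889729116598231774801586519617151911069708803264382202543943743115744047070718278707948391705800998365984713866804584916599699333809193741591470519927797538076007933781292674934070620316355244697500873138261780639536020757586942538012785737793461922125766836255516010957852657826419803262431317296956039676305968125213048462704704249419855955082530519132691393914504074629510034092488846489523112206888144828991443977256797894247673115488221270553959085066903193902666699966677308030663334030120252667833726460122094037126336534233882651412614543518766238090433245683098398505310314603062761824329248820859480084180625128680885594973952574229654456816775930948525300471501213827909342263244594831104771515674641477264452657455849250541114121431984018019891834560985365748948992602348991195586819341915148217077102223749731262677493950686612499699095118785869569265292645873577717772249746723468703493118316326137766988201961202650913767931375),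
   (4033, 36, 54, 111435845479648169644506322820862127026100831724729783670481976608349261790897020114299803151780848829611636436429321437947495520964180473738056518960147015567420379342163141983957635754364463526426581386318809229186443663538279621729639077463620361278935443627630951315414049734404120132969271472003641465848610650043886013760912908755382645506396959652622688046902574646692131698191606725653486812591779400127325692870728352852693539722119841077453805478906314601538915916612236183992320292674533559462166993009646883420022731854182933502141420313942164872184989512381946500695207456720763211527114076674377981610149018658205743259055172879694119002608099236538650698560819910284243266730739715708859597024810752387476990325702028061361431330084284571802508917560828918441030970450198992343992900370323108740662717480788366931594154062188988729568219304975743062902767468069880978790492820324750894836608602554705272909703061671143198109419342507182198929682826062064185429927240676258385866640727910768935785921903004798369139023875984276289026951608392958190696820091352358385209125979287776379653093517211344488294683282236120593299283062262286192252107403810619291737302083595426397667986468683266636389543871),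
   (3395, 48, 48, 99266299697372252351469130522426177762595015417675451610221693967337556064107888690530884695798358789328922669017483637156367163782441648220774827978844279070447010145275821472121767165010757820941381796537058316360023916834396843279922974005948777645875442312723104250432916112270542344140567433774450953518349331180329332468267562957822874368482565801714762040726394465417735179569183177973177378864200599661214993478463062118008083838057070605010690244046177322310802694785192631495708022486419772944393107921238405494742236098747442135046323716354355416660518242143221702553425753321436624542049902672506000077982006780080363217991725207228823467486229188130873898149368521145108876403424201655550771185194414778351824732833144909480253897561934316852877133368287638844963713668134361738392587370535569611568176765711248119802578733092104853917213097796019767773150453430321260493520008491870606337883771551659766336413655259597266286065754753859778054250309539646586651589976703821469023718708381393167769239405117439),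
   (2047, 11, 88, 15888928046848932687258028143786442472268718104343713054898658782547054143847852444920301635072113240846405889708706085567710636147636584205867910079004640652611275993530169345368961985141322711552856951063543367423898748414888914789808296897356209978657933552252495550236897519113690211541553015783721286553897917796486441057321682898279181406901656524778170198094723987896001817253690520383775573027269140558131455918565549351150472772470760306603369265342169732733439974190975544245356158459205051721361185248366887930119889651029292150301702433297116532791524893461613613564734857571240105532708395450553116310463),
   (4681, 15, 150, 1322198914797963995149363057980320408268811182784831512963174383393578110167046585899173621437065471793586037273937679121890414991738740786377990144446627718749921949754043381451643647072722449047457558274183836861878969683631418511981252030174462493836952427399157605641579196906285823797635840919112478674051104930356061267177692715487275991962546206964370952992902202182079895036533363030065255003071940690733175941914881598835670891477290542449810575423782835200802986858742027854955988019238885309259867666355703777241666228526933787422555661804643071792941829937111896491353893396732252082946080493352212381283411598369221247221998880735340693484212701138638808446276968841966747229698812521291783896495446749564484419227782262501737496780334306935531155993400692782865357867341215178141807609466171616912052834765056002024655414577332315664129865878742430820914918520506632736636060981798519358803971774998089138375849205431066452973789351211346916526097625299430462297535505135599422892513423209148264710909575617151426910871437798366700292122729741818624579512625066301428925354281949150358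67809123600691429879364092206516629919726764759247673330030033974108571724015394339048029874325698572352736523590503743867864778108345006987337085667225572416938486220435678401816681362878405011220202286276679875426626562350823863671872806893615341287882850499584634312981518498966573477818769532425011017478143),
   (1729, 36, 18, 27826562021323672861340415889964462103119957836629138055300367294346921469978975093555477859947226684551386090897160532979345922863892195703032117401894252004651473509537784858440667423850567022681076258154886586213714610180913301409760014104645957952810417312639928740875181374518644517754852820250979505549415667980776637309566430994415609040473410279960634202832781715088737614446305128915069013120602274239435790693954431923428218466269964736885019073110570282086595534581885184403128046086642706147804252832686321071),
   (455, 12, 12, 91370001494893020465078859470344889886025909079787203317327736545176952264060399655587750497634349352341657446687459155080905393737477567),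
   (2701, 36, 36, 1111927622450281875963227902590074924471487508474188651283858372089313957334361156475349967954492767306445854018451886542326593757372745131800822136576345067948458170558419390493309181305667592328179652746720817318767431553726050305615579150236266720984855002428583428062876234190909371382182748768110711322579279326085720565003146952308737599822343840104263781000630060412126024706837501784172880729834033305925819836262316832746934082040771033754657527046469265477683239845493969657105248254454959323558995815988409374105570248811690260562094740828328927228027317218709167485967927915221524224600048704425172616079839982808099775328498231586558287494186562374332955881883253174552567289480243230601187078388667236081344016042948407710887405793809006465955963842154929195239839798321994442608287347382410860473263),
   (3913, 84, 42, 8368815478149909277990445445571026165474605580732738458918035875856052968824444953922492622718664031888098786659917261705740092634204779084055675817268265759776011948623344474618154272641599138966413593222950902807735558657081073004912506423720623488550169427297608235283158266994261213881395140862137898555519888176750642836079702460239310852961863540357292660758625765320753999749418214116046583043672103806526536167025163200049293216369366238884704717392939648145749266468694302372491878167805723609024397013233209092627994997963416045254901691410952508168073083691733872321139256535467191379203557523559426624571040137051681381203874037702796552473041858518600170326966299557189581469302101853865542423704969228798224629477517105234387973675532125685395578833891066475584809125737801599771576052084162448413402007699852342930599644403290535881233566423287501941163250432006845293653847018892438603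4321400943933766794223181123931414802075297110833791794876451272664309022780315350900471617111759323383504414257423270018137736874721117632405684738827050569601435571005060727573171892721661223785954587537264632914812438726305996269223799499821970463586609745278844414887656895),
   (3277, 28, 112, 298717711010750390415682998934469369520564927204191943256539333107055298180382395494280280669681400103894534067795117577412346852882356283613718834141503424602115256060735002295046773190096856409410533963805531201466237495156681743466373206553824777739481804776262321731865871458779738423306046179671343719653242519676390165877883605350520527028435820926161600924613040862908220147957477750648076677025835693716063625636482891217640911638358491391804333419923376215666818524974883407608207413955474454134665542748048810927282296776396066172344303059580278336363349257321985977192194079749602133153259722483435920123852771659095361609404023263045885187814742405393564118521545608305494628152238966673011728785955130004015240068142183502400100924385039585253293871604672846198737920801949931835479960439399368075281228746305780571946912811938853565023856212549838707517551285021274884236281423820679456122818807967740964493803176472068285927020264029450615942995042002562112395077119295487),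
   (3731, 60, 24, 13635305909175913748607485536404470103007821908004881488556300876755882727916911017023090974725228657456284172321365569611149452490634478812694946412815057275161447999686359923765542460860808209763540183881143476440073829435743238218875845804962625015949741865429839738271608351757525858984220795000565845469435055770139798276886079764126434507223876472299244555655982378331760637184399585569846143992119865422609382127303079567378886597845203390711723988688959072138001382363423727748928324730989720200333216089183586212210705756697366602660032384956762455752450017413061499977238538947699080619757174174661291238934457693657815682605818197526081930208534820933962917339417595413689610231535697043246755238250505533842798490327111087050985481576031186735446641412836705101175528706380795044276269375650639145038805029610223732448630721428590850296902183283974196835224071068876106502297171087900809007314742811805420623089198592712456984581313550081621701239369540404858105538104564283525763111265225748894937629451423044335720990031514471755688294072713512500716149224120145708933736873630828366764510990937864962807097791),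
   (1649, 48, 48, 25029733355529727105306285114694795630351481925131826220915411737977822771595021965478478917908410310705506631867225679770545323840983123438088436127540588753005125956311075267363682063759915574439852150416035169749398177498552012359114367317399980264035228128570934368057629215408237473482132749582112738379798371453640332207772377535249503406487170204160099146104275279947619858812966572611889876190851431528055697060806725452714712310640778421827074034440338578777283795819134361806359052091391),
   (1661, 30, 50, 102523303319417525266765627560011833611434087252311261917998647853639976125743780845639182792063869217876344272396908897285328151402656400519258444423551140019460223187059585441818200606727702944278101145766678059552897636371956748526338191840045651012585807359219042285192609823965013943211666717891489956430586257850868795873246138407261554949212839366882427946854669601790128199084058774638819131068313274320099324395360559901595196780598124899967089134807377196722239351163300210240843943746994175),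
   (4369, 16, 256, 15849820228503086689432333140345606242816986263041754104426091173688935512292953717223821287224326443811120057201595858676263279271882656800470410947322091928497948464943950755045671589113329550094558152215851684594262493682814407442624998509326885263203003661425810171066910521694219849297636784792134572318870974514113411525609583916481930593636134888681258576758739829613626935747765918614972482510533921744388851023347588442550440134706951831313010934882318787923451709768059455847476867339520727097588584881476095231732221232494805885056151173104821801899184560225602201505435816406953631896097243455935089597444635827033134536150085871876654403769635063525692345589059412678500650479099504450727695672194221570708270543625928004752733640231861263210392907413676877945754002305234265110800868248842958471321107051883968113065494374313058105651771839078184977709118360051462901367828384899653864888902701796524848264890864549003023695282970674959319586096012975676515006377916881936949280426681211361492098983399573580558924287582856318209126554002409406988265380337131546091081432870495190166068061841791276767533295276807126768105132364288151018539151084815357087933425512825402313708112449162295487041080901094359343518451798675342048221266957586023869369639877763367075142630806012656323702605156185389645823)]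

/-- Rows `(q, l, d, e)` where `l` lists all values of `min (2 ^ a) (3 ^ b)` with
`|2 ^ a - 3 ^ b| = q`; `d` and `e` are certificates for the signs `+` and `-`. -/
def powDiffTable : List (ℕ × List ℕ × (ℕ × ℕ × ℕ × ℕ × ℕ) × (ℕ × ℕ × ℕ × ℕ × ℕ)) :=
  [(1, [1, 2, 3, 8], (3, 0, 1, 2, 8), (4, 0, 4, 4, 80)),
   (2, [1], (1, 0, 1, 1, 2), (1, 0, 1, 1, 2)), (3, [1], (0, 1, 2, 1, 3), (0, 1, 2, 1, 3)),
   (5, [3, 4, 27], (6, 0, 8, 16, 5440), (3, 0, 1, 2, 8)),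
   (7, [1, 2, 9], (5, 0, 8, 16, 2720), (3, 0, 1, 2, 8)),
   (8, [1], (1, 0, 1, 1, 2), (1, 0, 1, 1, 2)), (11, [16], (3, 0, 1, 2, 8), (5, 0, 8, 16, 2720)),
   (13, [3, 243], (9, 0, 16, 256, 11184640), (3, 0, 1, 2, 8)),
   (15, [1], (0, 1, 2, 1, 3), (0, 1, 2, 1, 3)),
   (17, [64], (3, 0, 1, 2, 8), (7, 0, 16, 256, 2796160)),
   (19, [8], (3, 0, 1, 2, 8), (4, 1, 4, 4, 240)),
   (23, [4, 9], (6, 0, 8, 16, 5440), (3, 0, 1, 2, 8)),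
   (25, [2], (3, 0, 1, 2, 8), (2, 1, 4, 4, 60)), (26, [1], (1, 0, 1, 1, 2), (1, 0, 1, 1, 2)),
   (29, [3], (2, 2, 6, 6, 252), (3, 0, 1, 2, 8)),
   (37, [27], (7, 0, 16, 256, 2796160), (3, 0, 1, 2, 8)),
   (47, [81], (8, 0, 16, 256, 5592320), (3, 0, 1, 2, 8)),
   (49, [32], (3, 0, 1, 2, 8), (6, 0, 8, 16, 5440)),
   (61, [3], (2, 2, 6, 6, 252), (3, 0, 1, 2, 8)),
   (65, [16], (3, 0, 1, 2, 8), (5, 0, 8, 16, 2720)),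
   (73, [8], (3, 0, 1, 2, 8), (4, 1, 4, 4, 240)), (79, [2], (2, 1, 4, 4, 60), (3, 0, 1, 2, 8)),
   (80, [1], (1, 0, 1, 1, 2), (1, 0, 1, 1, 2)),
   (119, [9], (0, 3, 18, 12, 13797), (3, 0, 1, 2, 8)),
   (227, [16], (3, 0, 1, 2, 8), (5, 0, 8, 16, 2720)),
   (242, [1], (1, 0, 1, 1, 2), (1, 0, 1, 1, 2)), (255, [1], (0, 1, 2, 1, 3), (0, 1, 2, 1, 3)),
   (431, [81], (10, 0, 16, 256, 22369280), (3, 0, 1, 2, 8)),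
   (503, [9], (0, 3, 18, 12, 13797), (3, 0, 1, 2, 8)),
   (32039, [729], (0, 7, 4374, 729, 38265939), (3, 0, 1, 2, 8))]

/-- The values of `-c` for which `c` has two representations with indices at most `500`. -/
def negValues : List ℕ :=
  [1, 2, 3, 4, 5, 6, 7, 8, 9, 11, 13, 14, 15, 16, 17, 20, 21, 23, 25, 29, 30, 32, 34, 35, 43, 44,
   46, 47, 52, 53, 54, 57, 61, 62, 63, 68, 69, 70, 78, 79, 89, 93, 94, 97, 110, 115, 125, 126,
   127, 133, 140, 181, 185, 190, 209, 212, 214, 241, 254, 277, 287, 309, 313, 317, 366, 377, 385,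
   425, 453, 483, 525, 569, 572, 645, 1134, 1249, 1294, 1457, 1529, 1681, 1726, 3438, 3765, 4590,
   5177, 6910, 11617, 15541, 20734, 31086, 62206, 82942, 559870]

/-! ### Small values of `|2 ^ a - 3 ^ b|` -/

/-- The `i`-th binary digit of `m`, as a Boolean. -/
def bitSet (m i : ℕ) : Bool := Nat.beq (Nat.mod (Nat.shiftRight m i) 2) 1

/-- Whether `q` passes all the sieves in `powDiffSieves`. -/
def passesSieves (q : ℕ) : Bool :=
  List.rec true (fun r _ rest => Bool.rec false rest (bitSet r.2.2.2 (Nat.mod q r.1)))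
    powDiffSieves

/-- The correctness of one row of `powDiffSieves`. -/
def sieveValid (r : ℕ × ℕ × ℕ × ℕ) : Bool :=
  Nat.beq (2 ^ r.2.1 % r.1) 1 && Nat.beq (3 ^ r.2.2.1 % r.1) 1 &&
    (List.range r.2.1).all fun a => (List.range r.2.2.1).all fun b =>
      bitSet r.2.2.2 ((2 ^ a + (r.1 - 3 ^ b % r.1)) % r.1) &&
        bitSet r.2.2.2 ((3 ^ b + (r.1 - 2 ^ a % r.1)) % r.1)

theorem powDiffSieves_valid : powDiffSieves.all sieveValid = true := by
  decide +kernel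

theorem pow_mod_eq_of_period {b m r : ℕ} (h : b ^ r % m = 1) (a : ℕ) :
    b ^ a ≡ b ^ (a % r) [MOD m] := by
  have h1 : b ^ r ≡ 1 [MOD m] := by
    have : 1 % m = 1 := by
      rw [← h, Nat.mod_mod]
    rw [Nat.ModEq, h, this]
  conv_lhs => rw [← Nat.mod_add_div a r, pow_add, pow_mul]
  simpa using (Nat.ModEq.refl (b ^ (a % r))).mul (h1.pow (a / r))

theorem mod_eq_of_add_modEq {x y m q : ℕ} (hm : 0 < m) (h : x ≡ y + q [MOD m]) :
    (x + (m - y % m)) % m = q % m := by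
  have hy := Nat.mod_lt y hm
  change x + (m - y % m) ≡ q [MOD m]
  apply Nat.ModEq.add_left_cancel (Nat.ModEq.refl y)
  calc y + (x + (m - y % m)) ≡ y % m + (x + (m - y % m)) [MOD m] :=
        (Nat.mod_modEq y m).symm.add_right _
    _ = x + m := by omega
    _ ≡ x [MOD m] := by simp [Nat.ModEq]
    _ ≡ y + q [MOD m] := h

theorem passesSieves_eq_true {q : ℕ}
    (h : ∀ r ∈ powDiffSieves, bitSet r.2.2.2 (q % r.1) = true) : passesSieves q = true := by
  unfold passesSieves
  generalize powDiffSieves = l at h ⊢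
  induction l with
  | nil => rfl
  | cons r l ih =>
    have h1 : bitSet r.2.2.2 (Nat.mod q r.1) = true := h r List.mem_cons_self
    simpa only [h1] using ih fun r' hr' => h r' (List.mem_cons_of_mem r hr')

theorem passesSieves_of_eq {a b q : ℕ} (h : 2 ^ a = 3 ^ b + q ∨ 3 ^ b = 2 ^ a + q) :
    passesSieves q = true := by
  refine passesSieves_eq_true fun r hr => ?_
  have hv := List.all_eq_true.1 powDiffSieves_valid r hr
  simp only [sieveValid, Bool.and_eq_true, Nat.beq_eq, List.all_eq_true, List.mem_range] at hv
  obtain ⟨⟨h2, h3⟩, hall⟩ := hv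
  have hpos : ∀ r ∈ powDiffSieves, 0 < r.1 ∧ 0 < r.2.1 ∧ 0 < r.2.2.1 := by decide +kernel
  obtain ⟨hm, hr2, hr3⟩ := hpos r hr
  have ha := pow_mod_eq_of_period h2 a
  have hb := pow_mod_eq_of_period h3 b
  have := hall (a % r.2.1) (Nat.mod_lt _ hr2) (b % r.2.2.1) (Nat.mod_lt _ hr3)
  rcases h with h | h
  · rw [← mod_eq_of_add_modEq hm (ha.symm.trans ((congrArg (· % r.1) h).trans (hb.add_right q)))]
    exact this.1
  · rw [← mod_eq_of_add_modEq hm (hb.symm.trans ((congrArg (· % r.1) h).trans (ha.add_right q)))]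
    exact this.2

/-- Certificate for the insolubility of `2 ^ a + s = 3 ^ b + t` with `a ≥ A` and `b ≥ B`. -/
def powDiffCert (A B r k m s t : ℕ) : Bool :=
  Nat.beq (2 ^ (A + r) % m) (2 ^ A % m) && Nat.beq (3 ^ (B + k) % m) (3 ^ B % m) &&
    Nat.beq (m % 3 ^ B) 0 &&
    (List.range r).all fun u => !Nat.beq ((2 ^ (A + u) + s) % 3 ^ B) (t % 3 ^ B) ||
      (List.range k).all fun v => !Nat.beq ((2 ^ (A + u) + s) % m) ((3 ^ (B + v) + t) % m)

theorem pow_add_mul_modEq {b m A r : ℕ} (h : b ^ (A + r) ≡ b ^ A [MOD m]) (u k : ℕ) :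
    b ^ (A + u + r * k) ≡ b ^ (A + u) [MOD m] := by
  induction k with
  | zero => rfl
  | succ k ih =>
    calc b ^ (A + u + r * (k + 1)) = b ^ (A + r) * b ^ (u + r * k) := by ring
      _ ≡ b ^ A * b ^ (u + r * k) [MOD m] := h.mul_right _
      _ = b ^ (A + u + r * k) := by ring
      _ ≡ b ^ (A + u) [MOD m] := ih

theorem pow_modEq_of_le {b m A r : ℕ} (h : b ^ (A + r) ≡ b ^ A [MOD m]) {a : ℕ} (ha : A ≤ a) :
    b ^ a ≡ b ^ (A + (a - A) % r) [MOD m] := by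
  have h1 := pow_add_mul_modEq h ((a - A) % r) ((a - A) / r)
  rwa [add_assoc, Nat.mod_add_div, Nat.add_sub_cancel' ha] at h1

theorem lt_or_lt_of_powDiffCert {A B r k m s t a b : ℕ} (hr : 0 < r) (hk : 0 < k)
    (hc : powDiffCert A B r k m s t = true) (h : 2 ^ a + s = 3 ^ b + t) : a < A ∨ b < B := by
  by_contra! hab
  simp only [powDiffCert, Bool.and_eq_true, Nat.beq_eq, List.all_eq_true, List.mem_range,
    Bool.or_eq_true, Bool.not_eq_true'] at hc
  obtain ⟨⟨⟨h2, h3⟩, hB⟩, hall⟩ := hc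
  have ha := pow_modEq_of_le h2 hab.1
  have hb := pow_modEq_of_le h3 hab.2
  have hm : 3 ^ B ∣ m := Nat.dvd_of_mod_eq_zero hB
  rcases hall _ (Nat.mod_lt (a - A) hr) with h' | h'
  · refine Nat.ne_of_beq_eq_false h' ?_
    calc 2 ^ (A + (a - A) % r) + s ≡ 2 ^ a + s [MOD 3 ^ B] := ((ha.of_dvd hm).add_right s).symm
      _ = 3 ^ b + t := h
      _ ≡ 0 + t [MOD 3 ^ B] :=
        ((Nat.modEq_zero_iff_dvd.2 (pow_dvd_pow 3 hab.2)).add_right t)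
      _ = t := zero_add t
  · refine Nat.ne_of_beq_eq_false (h' _ (Nat.mod_lt (b - B) hk)) ?_
    calc 2 ^ (A + (a - A) % r) + s ≡ 2 ^ a + s [MOD m] := (ha.add_right s).symm
      _ = 3 ^ b + t := h
      _ ≡ 3 ^ (B + (b - B) % k) + t [MOD m] := hb.add_right t

/-- The correctness of one row of `powDiffTable`. -/
def tableRowValid (r : ℕ × List ℕ × (ℕ × ℕ × ℕ × ℕ × ℕ) × (ℕ × ℕ × ℕ × ℕ × ℕ)) : Bool :=
  let certOk := fun (d : ℕ × ℕ × ℕ × ℕ × ℕ) (s t : ℕ) =>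
    Nat.ble d.1 16 && Nat.ble d.2.1 8 && Nat.ble 1 d.2.2.1 && Nat.ble 1 d.2.2.2.1 &&
      powDiffCert d.1 d.2.1 d.2.2.1 d.2.2.2.1 d.2.2.2.2 s t
  Nat.ble r.1 32768 && certOk r.2.2.1 0 r.1 && certOk r.2.2.2 r.1 0 &&
    (List.range 20).all fun a => (List.range 20).all fun b =>
      (!Nat.beq (2 ^ a) (3 ^ b + r.1) || r.2.1.any (Nat.beq (3 ^ b))) &&
        (!Nat.beq (3 ^ b) (2 ^ a + r.1) || r.2.1.any (Nat.beq (2 ^ a)))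

theorem powDiffTable_valid : powDiffTable.all tableRowValid = true := by
  decide +kernel

theorem lt_twenty_of_eq {a b s t : ℕ} (h : 2 ^ a + s = 3 ^ b + t) (hs : s ≤ 32768)
    (ht : t ≤ 32768) (hab : a < 16 ∨ b < 8) : a < 20 ∧ b < 20 := by
  have h2 : 20 ≤ a → 2 ^ 20 ≤ 2 ^ a := fun h => Nat.pow_le_pow_right (by norm_num) h
  have h3 : 20 ≤ b → 3 ^ 20 ≤ 3 ^ b := fun h => Nat.pow_le_pow_right (by norm_num) h
  rcases hab with ha | hb
  · have : 2 ^ a ≤ 2 ^ 16 := Nat.pow_le_pow_right (by norm_num) ha.le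
    exact ⟨by omega, by by_contra hb; have := h3 (by omega); omega⟩
  · have : 3 ^ b ≤ 3 ^ 8 := Nat.pow_le_pow_right (by norm_num) hb.le
    exact ⟨by by_contra ha; have := h2 (by omega); omega, by omega⟩

theorem mem_of_pow_diff_eq {r : ℕ × List ℕ × (ℕ × ℕ × ℕ × ℕ × ℕ) × (ℕ × ℕ × ℕ × ℕ × ℕ)}
    (hr : r ∈ powDiffTable) (a b : ℕ) :
    (2 ^ a = 3 ^ b + r.1 → 3 ^ b ∈ r.2.1) ∧ (3 ^ b = 2 ^ a + r.1 → 2 ^ a ∈ r.2.1) := by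
  have hv := List.all_eq_true.1 powDiffTable_valid r hr
  simp only [tableRowValid, Bool.and_eq_true, Nat.beq_eq, List.all_eq_true, List.mem_range,
    Bool.or_eq_true, Bool.not_eq_true', Nat.ble_eq, List.any_eq_true, exists_eq_right'] at hv
  obtain ⟨⟨⟨hq, ⟨⟨⟨hA, hB⟩, hr⟩, hk⟩, hd⟩, ⟨⟨⟨hA', hB'⟩, hr'⟩, hk'⟩, he⟩, hall⟩ := hv
  constructor <;> intro h
  · have hlt := lt_or_lt_of_powDiffCert hr hk hd (h : 2 ^ a + 0 = _)
    have h20 := lt_twenty_of_eq (s := 0) (b := b) h (by omega) hq (by omega)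
    exact (hall a h20.1 b h20.2).1.resolve_left fun h' => Nat.ne_of_beq_eq_false h' h
  · have hlt := lt_or_lt_of_powDiffCert hr' hk' he (h.symm : _ = 3 ^ b + 0)
    have h20 := lt_twenty_of_eq (t := 0) (a := a) h.symm hq (by omega) (by omega)
    exact (hall a h20.1 b h20.2).2.resolve_left fun h' => Nat.ne_of_beq_eq_false h' h

/-! ### Values of `c` with two representations

The search below is written with recursors and the primitive operations on `ℕ`, since it is
evaluated by the kernel. -/

/-- `f n`, arranged so that the kernel evaluates `n` before unfolding `f`. -/
def withValue {α : Type} (n : ℕ) (f : ℕ → α) : α :=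
  Nat.rec (f 0) (fun k _ => f (Nat.succ k)) n

theorem withValue_eq {α : Type} (n : ℕ) (f : ℕ → α) : withValue n f = f n := by
  cases n <;> rfl

/-- Whether `-k` is nonnegative, or is one of the listed negative values. -/
def negListed (k : ℕ) : Bool := Nat.ble k 0 || negValues.any (Nat.beq k)

/-- An upper bound for the exponents in all 3-smooth numbers that occur in the search. -/
@[irreducible] def smoothBound : ℕ := 600

/-- Whether all common values `lo - g * s = hi - g * t` with `hi - lo = g * q` and coprime
3-smooth numbers `s` and `t` are nonnegative or listed. -/
def quotientOk (lo g q : ℕ) : Bool :=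
  Bool.rec false
    (Bool.rec true
      (powDiffTable.any fun r => Nat.beq r.1 q && r.2.1.all fun s => negListed (g * s - lo))
      (passesSieves q))
    (Nat.rec (negListed (g - lo)) (fun _ _ => true) (Nat.mod (Nat.pow 6 smoothBound) (Nat.succ q)))

/-- `quotientOk` for all ways to move a power of 3 from `q` to `g`. -/
def stripThree (lo f : ℕ) : ℕ → ℕ → Bool :=
  Nat.rec (fun _ _ => false) (fun _ rest g q =>
    Bool.rec false
      (Nat.rec (rest (Nat.mul g 3) (Nat.div q 3)) (fun _ _ => true) (Nat.mod q 3))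
      (quotientOk lo g q)) f

/-- `quotientOk` for all ways to move a 3-smooth factor from `q` to `g`. -/
def stripTwo (lo f : ℕ) : ℕ → ℕ → Bool :=
  Nat.rec (fun _ _ => false) (fun _ rest g q =>
    Bool.rec false
      (Nat.rec (rest (Nat.mul g 2) (Nat.div q 2)) (fun _ _ => true) (Nat.mod q 2))
      (stripThree lo 20 g q)) f

/-- The search for common values for `u` and `v`. -/
def pairOk (u v : ℕ) : Bool :=
  withValue (Nat.add (Nat.sub u v) (Nat.sub v u)) fun d => stripTwo (u - (u - v)) 20 1 d

/-- `pairOk` for all pairs of entries of a list, one of which is among the first `k` entries. -/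
def allPairs : ℕ → List ℕ → Bool
  | 0, _ => true
  | _ + 1, [] => true
  | k + 1, u :: l => l.all (pairOk u) && allPairs k l

/-- The first `k` terms of the Lucas recurrence started at `u`, `v`. -/
def lucasList : ℕ → ℕ → ℕ → List ℕ
  | 0, _, _ => []
  | k + 1, u, v => u :: withValue v fun v' => withValue (u + v) fun w => lucasList k v' w

theorem quotientOk_iff {lo g q : ℕ} :
    quotientOk lo g q = true ↔ (6 ^ smoothBound % (q + 1) = 0 → negListed (g - lo) = true) ∧
      (passesSieves q = true → ∃ r ∈ powDiffTable, r.1 = q ∧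
        ∀ s ∈ r.2.1, negListed (g * s - lo) = true) := by
  have h6 : Nat.mod (Nat.pow 6 smoothBound) (Nat.succ q) = 6 ^ smoothBound % (q + 1) := rfl
  unfold quotientOk
  rw [h6]
  cases 6 ^ smoothBound % (q + 1) <;> cases negListed (g - lo) <;> cases passesSieves q <;> simp

theorem negListed_of_smooth {lo g q a b : ℕ} (h : quotientOk lo g q = true)
    (hq : q + 1 = 2 ^ a * 3 ^ b) (hlt : q < 2 ^ smoothBound) : negListed (g - lo) = true := by
  refine (quotientOk_iff.1 h).1 (Nat.mod_eq_zero_of_dvd ?_)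
  have hle : 2 ^ a * 3 ^ b ≤ 2 ^ smoothBound := by omega
  have h2 : 2 ^ a ≤ 2 ^ smoothBound := (Nat.le_mul_of_pos_right _ (by positivity)).trans hle
  have h3 : 2 ^ b ≤ 2 ^ smoothBound := (Nat.pow_le_pow_left (by norm_num) b).trans
    ((Nat.le_mul_of_pos_left (3 ^ b) (by positivity : 0 < 2 ^ a)).trans hle)
  rw [hq, show 6 = 2 * 3 from rfl, mul_pow]
  exact mul_dvd_mul (pow_dvd_pow 2 ((Nat.pow_le_pow_iff_right (by norm_num)).1 h2))
    (pow_dvd_pow 3 ((Nat.pow_le_pow_iff_right (by norm_num)).1 h3))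

theorem negListed_of_pow_diff {lo g q a b : ℕ} (h : quotientOk lo g q = true) :
    (2 ^ a = 3 ^ b + q → negListed (g * 3 ^ b - lo) = true) ∧
      (3 ^ b = 2 ^ a + q → negListed (g * 2 ^ a - lo) = true) := by
  constructor <;> intro hq
  · obtain ⟨r, hr, rfl, hall⟩ := (quotientOk_iff.1 h).2 (passesSieves_of_eq (Or.inl hq))
    exact hall _ ((mem_of_pow_diff_eq hr a b).1 hq)
  · obtain ⟨r, hr, rfl, hall⟩ := (quotientOk_iff.1 h).2 (passesSieves_of_eq (Or.inr hq))
    exact hall _ ((mem_of_pow_diff_eq hr a b).2 hq)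

theorem stripThree_succ_iff {lo f g q : ℕ} : stripThree lo (f + 1) g q = true ↔
    quotientOk lo g q = true ∧ (q % 3 = 0 → stripThree lo f (g * 3) (q / 3) = true) := by
  change Bool.rec false (Nat.rec (stripThree lo f (g * 3) (q / 3)) (fun _ _ => true) (q % 3))
    (quotientOk lo g q) = true ↔ _
  cases quotientOk lo g q <;> cases q % 3 <;> simp

theorem stripTwo_succ_iff {lo f g q : ℕ} : stripTwo lo (f + 1) g q = true ↔
    stripThree lo 20 g q = true ∧ (q % 2 = 0 → stripTwo lo f (g * 2) (q / 2) = true) := by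
  change Bool.rec false (Nat.rec (stripTwo lo f (g * 2) (q / 2)) (fun _ _ => true) (q % 2))
    (stripThree lo 20 g q) = true ↔ _
  cases stripThree lo 20 g q <;> cases q % 2 <;> simp

theorem quotientOk_of_stripThree {lo f g q j : ℕ} (h : stripThree lo f g (3 ^ j * q) = true) :
    quotientOk lo (g * 3 ^ j) q = true := by
  induction f generalizing g j with
  | zero => exact absurd h Bool.false_ne_true
  | succ f ih =>
    rw [stripThree_succ_iff] at h
    cases j with
    | zero => simpa using h.1
    | succ j =>
      have h3 : 3 ^ (j + 1) * q = 3 * (3 ^ j * q) := by ring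
      rw [h3, Nat.mul_mod_right, Nat.mul_div_cancel_left _ (by norm_num)] at h
      rw [pow_succ', ← mul_assoc]
      exact ih (h.2 rfl)

theorem quotientOk_of_stripTwo {lo f g q i j : ℕ}
    (h : stripTwo lo f g (2 ^ i * 3 ^ j * q) = true) :
    quotientOk lo (g * (2 ^ i * 3 ^ j)) q = true := by
  induction f generalizing g i with
  | zero => exact absurd h Bool.false_ne_true
  | succ f ih =>
    rw [stripTwo_succ_iff] at h
    cases i with
    | zero => simpa using quotientOk_of_stripThree (by simpa using h.1)
    | succ i =>
      have h2 : 2 ^ (i + 1) * 3 ^ j * q = 2 * (2 ^ i * 3 ^ j * q) := by ring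
      rw [h2, Nat.mul_mod_right, Nat.mul_div_cancel_left _ (by norm_num)] at h
      rw [show g * (2 ^ (i + 1) * 3 ^ j) = g * 2 * (2 ^ i * 3 ^ j) by ring]
      exact ih (h.2 rfl)

theorem negListed_of_stripTwo {lo hi k x₁ y₁ x₂ y₂ f : ℕ} (hlt : lo < hi)
    (hhi : hi < 2 ^ smoothBound)
    (h : stripTwo lo f 1 (hi - lo) = true) (h₁ : hi + k = 2 ^ x₁ * 3 ^ y₁)
    (h₂ : lo + k = 2 ^ x₂ * 3 ^ y₂) : negListed k = true := by
  have key : ∀ i j s t, 2 ^ x₁ * 3 ^ y₁ = 2 ^ i * 3 ^ j * s → 2 ^ x₂ * 3 ^ y₂ = 2 ^ i * 3 ^ j * t →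
      ∃ q, s = t + q ∧ q < 2 ^ smoothBound ∧ quotientOk lo (2 ^ i * 3 ^ j) q = true ∧
        k = 2 ^ i * 3 ^ j * t - lo := by
    intro i j s t hs ht
    have hg : 0 < 2 ^ i * 3 ^ j := by positivity
    have hst : t < s := lt_of_mul_lt_mul_left (by omega : 2 ^ i * 3 ^ j * t < 2 ^ i * 3 ^ j * s)
      hg.le
    obtain ⟨q, rfl⟩ := Nat.exists_eq_add_of_lt hst
    have hd : hi - lo = 2 ^ i * 3 ^ j * (q + 1) := by
      have : 2 ^ i * 3 ^ j * (t + q + 1) = 2 ^ i * 3 ^ j * t + 2 ^ i * 3 ^ j * (q + 1) := by ring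
      omega
    have hle : q + 1 ≤ hi - lo := hd ▸ Nat.le_mul_of_pos_left _ hg
    refine ⟨q + 1, by omega, by omega, ?_, by omega⟩
    rw [hd] at h
    simpa using quotientOk_of_stripTwo h
  rcases le_total x₂ x₁ with hx | hx <;> rcases le_total y₂ y₁ with hy | hy <;>
    obtain ⟨a, rfl⟩ := Nat.exists_eq_add_of_le hx <;>
    obtain ⟨b, rfl⟩ := Nat.exists_eq_add_of_le hy
  · obtain ⟨q, hq, hlt, hok, rfl⟩ := key x₂ y₂ (2 ^ a * 3 ^ b) 1 (by ring) (by ring)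
    simpa using negListed_of_smooth hok (by rw [hq, add_comm]) (by omega)
  · obtain ⟨q, hq, -, hok, rfl⟩ := key x₂ y₁ (2 ^ a) (3 ^ b) (by ring) (by ring)
    exact (negListed_of_pow_diff hok).1 hq
  · obtain ⟨q, hq, -, hok, rfl⟩ := key x₁ y₂ (3 ^ b) (2 ^ a) (by ring) (by ring)
    exact (negListed_of_pow_diff hok).2 hq
  · have : 2 ^ x₁ * 3 ^ y₁ ≤ 2 ^ (x₁ + a) * 3 ^ (y₁ + b) :=
      Nat.mul_le_mul (Nat.pow_le_pow_right (by norm_num) (by omega))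
        (Nat.pow_le_pow_right (by norm_num) (by omega))
    omega

theorem negListed_of_pairOk {u v k x₁ y₁ x₂ y₂ : ℕ} (hne : u ≠ v) (hu : u < 2 ^ smoothBound)
    (hv : v < 2 ^ smoothBound) (h : pairOk u v = true) (h₁ : u + k = 2 ^ x₁ * 3 ^ y₁)
    (h₂ : v + k = 2 ^ x₂ * 3 ^ y₂) : negListed k = true := by
  rw [pairOk, withValue_eq] at h
  rcases hne.lt_or_gt with hlt | hlt
  · refine negListed_of_stripTwo (f := 20) hlt hv ?_ h₂ h₁
    convert h using 1
    simp [Nat.sub_eq_zero_of_le hlt.le]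
  · refine negListed_of_stripTwo (f := 20) hlt hu ?_ h₁ h₂
    convert h using 1
    simp [Nat.sub_eq_zero_of_le hlt.le, Nat.sub_sub_self hlt.le]

theorem stripTwo_zero {lo f g : ℕ} : stripTwo lo f g 0 = false := by
  induction f generalizing g with
  | zero => rfl
  | succ f ih =>
    refine Bool.eq_false_of_not_eq_true fun h => ?_
    simpa [ih] using (stripTwo_succ_iff.1 h).2 rfl

theorem pairOk_self (u : ℕ) : pairOk u u = false := by
  rw [pairOk, withValue_eq]
  change stripTwo (u - (u - u)) 20 1 ((u - u) + (u - u)) = false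
  rw [Nat.sub_self, stripTwo_zero]

/-- The Lucas sequence as a sequence of natural numbers. -/
def lucasNat : ℕ → ℕ
  | 0 => 2
  | 1 => 1
  | n + 2 => lucasNat (n + 1) + lucasNat n

theorem lucas_eq_lucasNat : ∀ n, lucas n = lucasNat n
  | 0 => rfl
  | 1 => rfl
  | n + 2 => by
    rw [lucas, lucasNat, lucas_eq_lucasNat (n + 1), lucas_eq_lucasNat n, Nat.cast_add]

theorem lucasNat_lt : ∀ n, lucasNat n < 2 ^ (n + 2)
  | 0 => by decide
  | 1 => by decide
  | n + 2 => by
    have h1 := lucasNat_lt (n + 1)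
    have h2 := lucasNat_lt n
    have h3 : 2 ^ (n + 2 + 2) = 2 ^ (n + 1 + 2) + 2 ^ (n + 2) + 2 ^ (n + 2) := by ring
    rw [lucasNat]
    omega

theorem lucasList_getElem? {k m i : ℕ} (h : i < k) :
    (lucasList k (lucasNat m) (lucasNat (m + 1)))[i]? = some (lucasNat (m + i)) := by
  induction k generalizing m i with
  | zero => omega
  | succ k ih =>
    simp only [lucasList, withValue_eq]
    cases i with
    | zero => simp
    | succ i =>
      rw [List.getElem?_cons_succ, show lucasNat m + lucasNat (m + 1) = lucasNat (m + 1 + 1) from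
        add_comm .., ih (by omega), Nat.add_right_comm, Nat.add_assoc]

theorem pairOk_of_allPairs {k i j u v : ℕ} {l : List ℕ} (h : allPairs k l = true) (hi : i < k)
    (hij : i < j) (hu : l[i]? = some u) (hv : l[j]? = some v) : pairOk u v = true := by
  induction l generalizing k i j with
  | nil => simp at hu
  | cons w l ih =>
    obtain ⟨k, rfl⟩ := Nat.exists_eq_add_of_lt hi
    obtain ⟨j, rfl⟩ := Nat.exists_eq_add_of_lt hij
    simp only [allPairs, Bool.and_eq_true, List.all_eq_true] at h
    rw [List.getElem?_cons_succ] at hv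
    cases i with
    | zero =>
      rw [List.getElem?_cons_zero, Option.some_inj] at hu
      exact hu ▸ h.1 v (List.mem_of_getElem? hv)
    | succ i =>
      rw [List.getElem?_cons_succ] at hu
      exact ih h.2 (by omega) (by omega) hu hv

theorem allPairs_lucasList_part₁ : allPairs 60 (lucasList 501 2 1) = true := by
  decide +kernel

theorem allPairs_lucasList_part₂ : allPairs 70 ((lucasList 501 2 1).drop 60) = true := by
  decide +kernel

theorem allPairs_lucasList_part₃ : allPairs 90 ((lucasList 501 2 1).drop 130) = true := by
  decide +kernel

theorem allPairs_lucasList_part₄ : allPairs 281 ((lucasList 501 2 1).drop 220) = true := by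
  decide +kernel

theorem pairOk_lucasNat {i j : ℕ} (hij : i < j) (hj : j ≤ 500) :
    pairOk (lucasNat i) (lucasNat j) = true := by
  have hget : ∀ i, i < 501 → (lucasList 501 2 1)[i]? = some (lucasNat i) := fun i hi => by
    rw [← Nat.zero_add i]
    exact (Nat.zero_add i).symm ▸ lucasList_getElem? (m := 0) hi
  have hsplit : ∀ k s, allPairs k ((lucasList 501 2 1).drop s) = true → s ≤ i → i < s + k →
      pairOk (lucasNat i) (lucasNat j) = true := fun k s h hs hi => by
    refine pairOk_of_allPairs (i := i - s) (j := j - s) h (by omega) (by omega) ?_ ?_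
    · rw [List.getElem?_drop, Nat.add_sub_cancel' hs, hget i (by omega)]
    · rw [List.getElem?_drop, Nat.add_sub_cancel' (by omega), hget j (by omega)]
  rcases lt_or_ge i 60 with h1 | h1
  · exact hsplit 60 0 allPairs_lucasList_part₁ (by omega) (by omega)
  rcases lt_or_ge i 130 with h2 | h2
  · exact hsplit 70 60 allPairs_lucasList_part₂ (by omega) (by omega)
  rcases lt_or_ge i 220 with h3 | h3
  · exact hsplit 90 130 allPairs_lucasList_part₃ (by omega) (by omega)
  · exact hsplit 281 220 allPairs_lucasList_part₄ (by omega) (by omega)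

theorem mem_negValues {k i j x₁ y₁ x₂ y₂ : ℕ} (hk : 0 < k) (hij : i < j) (hj : j ≤ 500)
    (h₁ : lucasNat j + k = 2 ^ x₁ * 3 ^ y₁) (h₂ : lucasNat i + k = 2 ^ x₂ * 3 ^ y₂) :
    k ∈ negValues := by
  have hlt : ∀ m ≤ 500, lucasNat m < 2 ^ smoothBound := fun m hm =>
    (lucasNat_lt m).trans_le (Nat.pow_le_pow_right (by norm_num) (by rw [smoothBound]; omega))
  have hok := pairOk_lucasNat hij hj
  have hne : lucasNat i ≠ lucasNat j := fun h => by simp [h, pairOk_self] at hok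
  have h := negListed_of_pairOk hne (hlt i (by omega)) (hlt j hj) hok h₂ h₁
  simp only [negListed, Bool.or_eq_true, Nat.ble_eq, List.any_eq_true, Nat.beq_eq,
    exists_eq_right'] at h
  exact h.resolve_left (by omega)

/-- Rows `(m, p, d, e)` where `p` is a period of the Lucas sequence modulo `m`, and `d` and `e` are
the orders of 2 and 3 modulo the parts of `m` prime to 2 and 3, respectively. -/
def moduli : List (ℕ × ℕ × ℕ × ℕ) :=
  [(2, 3, 1, 1), (3, 8, 2, 1), (4, 6, 1, 2), (5, 4, 4, 4), (7, 16, 3, 6), (8, 12, 1, 2),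
   (9, 24, 6, 1), (11, 10, 10, 5), (13, 28, 12, 3), (16, 24, 1, 4), (17, 36, 8, 16),
   (19, 18, 18, 18), (27, 72, 18, 1), (29, 14, 28, 28), (31, 30, 5, 30), (32, 48, 1, 8),
   (41, 40, 20, 8), (61, 60, 60, 10), (64, 96, 1, 16), (71, 70, 35, 35), (81, 216, 54, 1),
   (109, 108, 36, 27), (127, 256, 7, 126), (128, 192, 1, 32), (151, 50, 15, 50),
   (181, 90, 180, 45), (241, 240, 24, 120), (243, 648, 162, 1), (256, 384, 1, 64),
   (271, 270, 135, 30), (281, 56, 70, 280), (421, 84, 420, 105), (512, 768, 1, 128),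
   (641, 640, 64, 640), (729, 1944, 486, 1), (769, 192, 384, 48), (811, 270, 270, 810),
   (1009, 126, 504, 168), (1024, 1536, 1, 256), (1201, 1200, 300, 300), (1601, 160, 400, 1600),
   (1621, 810, 1620, 45), (1801, 1800, 25, 450), (2048, 3072, 1, 512), (2161, 80, 1080, 216),
   (2187, 5832, 1458, 1), (2269, 324, 2268, 42), (2521, 120, 1260, 126), (3361, 3360, 168, 1680),
   (3889, 3888, 648, 81), (4051, 1350, 50, 810), (4096, 6144, 1, 1024), (4481, 128, 560, 4480),
   (4801, 4800, 1200, 240), (6481, 3240, 810, 24), (6561, 17496, 4374, 1),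
   (7561, 7560, 3780, 1260), (8101, 4050, 100, 810), (8192, 12288, 1, 2048),
   (8641, 720, 4320, 2160), (9721, 9720, 810, 4860), (10369, 10368, 1296, 5184),
   (12289, 6144, 6144, 512), (14401, 7200, 3600, 80), (15361, 7680, 3840, 640),
   (16384, 24576, 1, 4096), (19441, 324, 4860, 54), (19683, 52488, 13122, 1),
   (21601, 21600, 1080, 2700), (21871, 810, 10935, 810), (23041, 11520, 480, 11520),
   (25601, 3200, 400, 25600), (30241, 6048, 540, 1512), (32768, 49152, 1, 8192),
   (43201, 1350, 7200, 10800), (45361, 5040, 22680, 2268), (52489, 13122, 13122, 2187),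
   (57601, 28800, 2400, 2880), (58321, 1458, 29160, 729), (59049, 157464, 39366, 1),
   (65536, 98304, 1, 16384), (68041, 17010, 34020, 34020), (77761, 25920, 38880, 38880),
   (81649, 27216, 20412, 40824), (96769, 96768, 24192, 1152), (102061, 20412, 102060, 51030),
   (103681, 144, 25920, 17280), (115201, 115200, 225, 57600), (131072, 196608, 1, 32768),
   (138241, 9216, 34560, 69120), (139969, 139968, 5832, 972), (155521, 38880, 38880, 405),
   (163841, 163840, 81920, 163840), (172801, 172800, 14400, 43200), (177147, 472392, 118098, 1),
   (196831, 196830, 98415, 196830), (241921, 80640, 60480, 2016), (259201, 32400, 1296, 64800),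
   (262144, 393216, 1, 65536), (286721, 143360, 640, 40960), (311041, 103680, 38880, 155520),
   (408241, 408240, 204120, 22680), (414721, 51840, 160, 13824), (459271, 459270, 2835, 459270),
   (466561, 466560, 46656, 23328), (524288, 786432, 1, 131072), (531441, 1417176, 354294, 1),
   (737281, 368640, 368640, 36864), (921601, 460800, 11520, 25600), (1048576, 1572864, 1, 262144),
   (1088641, 1088640, 77760, 272160), (1102249, 367416, 45927, 275562),
   (1179649, 1179648, 294912, 589824), (1377811, 459270, 1377810, 275562),
   (1451521, 1451520, 725760, 241920)]

/-- Certificates for the insolubility of `L n + k = 2 ^ x * 3 ^ y`. The entries of a row are `k`,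
the stages for large `x` and `y`, the lists of stages for `y = 0, 1, …` and large `x`, and the lists
of stages for `x = 0, 1, …` and large `y`. -/
def certificates :
    List (ℕ × List (ℕ × ℕ × ℕ × ℕ) × List (List (ℕ × ℕ × ℕ × ℕ)) × List (List (ℕ × ℕ × ℕ × ℕ))) :=
  [(1, [(24, 1, 1, 9), (1, 4, 4, 5), (5, 5, 2, 41), (1, 3, 5, 61), (1, 1, 1, 11), (2, 1, 3, 7),
    (1, 1, 1, 31)], [[(3, 1, 1, 2), (8, 2, 1, 3), (1, 1, 1, 4), (1, 1, 1, 8), (1, 1, 1, 16)], [(3,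
    1, 1, 2), (8, 2, 1, 9), (1, 1, 1, 4), (1, 1, 1, 8), (2, 1, 1, 32), (3, 9, 1, 19), (1, 1, 1,
    7)]], []),
   (2, [(12, 1, 1, 8)], [], [[(3, 1, 1, 2), (24, 1, 1, 27), (1, 1, 16, 17), (1, 1, 1, 5)], [(24,
    1, 1, 9), (1, 1, 1, 2), (1, 1, 1, 4)], [(3, 1, 1, 2), (2, 1, 1, 4), (4, 1, 1, 3), (1, 1, 4, 5),
    (2, 1, 3, 7), (27, 1, 7, 2269), (1, 1, 1, 243)]]),
   (3, [(8, 1, 1, 3), (3, 1, 1, 9), (2, 3, 6, 7), (5, 10, 5, 11), (1, 1, 1, 31), (1, 2, 4, 41)],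
    [[(6, 1, 1, 4), (2, 1, 1, 8), (2, 1, 1, 16), (1, 2, 1, 3), (2, 1, 1, 32), (2, 1, 1, 64), (8, 7,
    1, 127)], [(24, 1, 1, 16), (1, 1, 1, 3)]], []),
   (4, [(24, 1, 1, 9), (1, 4, 4, 5), (5, 5, 2, 41), (3, 2, 2, 17)], [[(3, 1, 1, 2), (2, 1, 1, 4),
    (4, 2, 1, 3), (1, 1, 1, 16), (2, 1, 1, 32)], [(24, 2, 1, 9), (1, 1, 1, 2), (1, 1, 1, 4)]], []),
   (5, [(24, 1, 1, 9), (1, 1, 1, 2)], [[(3, 1, 1, 2), (2, 1, 1, 4), (2, 1, 1, 8), (2, 1, 1, 16),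
    (1, 2, 1, 3), (2, 1, 1, 32), (16, 7, 1, 127), (1, 1, 1, 64), (1, 1, 1, 256)], [(24, 1, 1, 16),
    (1, 1, 1, 3)]], [[(3, 1, 1, 2), (8, 1, 1, 3), (1, 1, 1, 9), (3, 1, 16, 17), (1, 1, 1, 27), (1,
    1, 1, 5), (3, 1, 1, 81), (15, 1, 3, 6481), (1, 1, 1, 243)]]),
   (6, [(8, 1, 1, 3), (3, 1, 1, 9), (3, 1, 1, 27), (1, 8, 16, 17), (1, 1, 1, 5), (5, 5, 1, 41)],
    [[(24, 1, 1, 16)], [(24, 1, 1, 16)], [(24, 1, 1, 9), (1, 1, 1, 2)]], []),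
   (7, [(8, 1, 1, 3), (3, 1, 1, 9), (3, 1, 1, 27), (3, 1, 1, 81), (1, 8, 16, 17), (1, 1, 1, 5),
    (1, 9, 9, 19)], [[(6, 1, 1, 4), (4, 2, 1, 3), (1, 1, 1, 8), (1, 1, 1, 16)], [(6, 1, 1, 4), (8,
    3, 1, 7), (1, 1, 1, 8), (1, 1, 1, 16), (1, 1, 1, 32)], [(24, 1, 1, 9), (1, 1, 1, 2), (1, 1, 1,
    4), (1, 1, 1, 8)], [(24, 1, 1, 9), (1, 1, 1, 2), (1, 1, 1, 4), (1, 1, 1, 8)]], []),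
   (8, [(24, 1, 1, 9), (3, 1, 1, 27), (1, 8, 16, 17), (1, 1, 1, 5), (5, 5, 1, 41), (1, 3, 5, 61)],
    [[(12, 1, 1, 8)], [(12, 1, 1, 8)], [(12, 1, 1, 8)]], []),
   (9, [(24, 1, 1, 9), (1, 1, 1, 2)], [[(3, 1, 1, 2), (16, 3, 1, 7), (1, 1, 1, 4), (1, 1, 1, 8),
    (1, 1, 1, 16), (1, 1, 1, 32), (5, 8, 1, 241), (1, 1, 1, 3)], [(24, 1, 1, 16), (1, 1, 1, 3)]],
    [[(3, 1, 1, 2), (8, 1, 1, 3), (3, 1, 1, 27), (3, 1, 27, 109), (1, 1, 1, 81)]]),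
   (11, [(72, 1, 1, 27), (1, 8, 16, 17), (1, 1, 1, 5), (5, 5, 1, 41), (1, 3, 5, 61), (1, 1, 1,
    11)], [[(6, 1, 1, 4), (4, 2, 1, 3), (1, 1, 1, 8), (1, 1, 1, 16)], [(24, 2, 1, 9), (1, 1, 1, 2),
    (1, 1, 1, 4), (1, 1, 1, 8)], [(6, 1, 1, 4), (2, 4, 1, 5), (1, 1, 1, 8)]], []),
   (13, [(24, 1, 1, 9), (3, 1, 1, 27), (1, 8, 16, 17), (1, 1, 1, 5), (5, 5, 1, 41), (2, 3, 15,
    241), (1, 1, 1, 31), (1, 3, 3, 181)], [[(3, 1, 1, 2), (16, 3, 1, 7), (1, 1, 1, 4), (1, 1, 1,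
    8), (1, 1, 1, 16), (1, 1, 1, 32)], [(24, 1, 1, 16), (1, 1, 1, 3)], [(24, 1, 1, 9), (1, 1, 1,
    2)]], []),
   (14, [(24, 1, 1, 9), (3, 1, 1, 27), (1, 8, 16, 17), (1, 1, 1, 5), (5, 5, 1, 41), (2, 3, 15,
    241), (1, 1, 1, 31), (1, 3, 3, 181)], [[(96, 1, 1, 64)], [(48, 1, 1, 32), (1, 1, 1, 3)], [(24,
    1, 1, 9), (1, 1, 1, 4)]], []),
   (15, [(8, 1, 1, 3), (3, 1, 1, 9), (3, 1, 1, 27), (1, 8, 16, 17), (1, 1, 1, 5), (1, 9, 9, 19)],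
    [[(6, 1, 1, 4), (8, 3, 1, 7), (1, 1, 1, 8), (1, 1, 1, 16), (1, 1, 1, 32)], [(24, 1, 1, 16), (1,
    1, 1, 3)], [(24, 1, 1, 9), (1, 1, 1, 4)]], []),
   (16, [(12, 1, 1, 8)], [], [[(3, 1, 1, 2), (24, 1, 1, 27), (1, 1, 4, 5), (3, 1, 27, 109), (1, 1,
    1, 81)], [(72, 1, 1, 27), (1, 1, 1, 2)], [(24, 1, 1, 9), (1, 1, 1, 2), (1, 1, 1, 4)]]),
   (17, [(24, 1, 1, 9), (3, 1, 1, 27), (3, 1, 1, 81), (1, 8, 16, 17), (1, 1, 1, 5), (5, 5, 1, 41),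
    (1, 3, 5, 61), (1, 9, 3, 271)], [[(3, 1, 1, 2), (2, 1, 1, 4), (2, 1, 1, 8), (2, 1, 1, 16), (1,
    2, 1, 3), (2, 1, 1, 32), (16, 7, 1, 127), (1, 1, 1, 64), (1, 1, 1, 128)], [(24, 1, 1, 16), (1,
    1, 1, 3)], [(24, 1, 1, 9), (1, 1, 1, 4), (1, 1, 1, 16)], [(24, 1, 1, 9), (1, 1, 1, 4), (1, 1,
    1, 16)]], []),
   (20, [(3, 1, 1, 2), (8, 1, 1, 3), (1, 1, 1, 9), (1, 4, 4, 5), (5, 5, 2, 41), (3, 2, 2, 17)],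
    [[(3, 1, 1, 2), (16, 3, 1, 7), (1, 1, 1, 4), (1, 1, 1, 16), (1, 1, 1, 32)], [(3, 1, 1, 2), (2,
    1, 1, 4), (4, 1, 1, 3), (1, 1, 1, 16), (1, 2, 1, 9), (1, 2, 1, 5), (3, 2, 1, 17), (2, 3, 1, 7),
    (4, 16, 1, 769), (1, 1, 1, 64)]], [[(3, 1, 1, 2), (8, 1, 1, 3), (1, 1, 1, 9), (5, 1, 10, 61),
    (1, 1, 1, 11), (9, 1, 3, 271), (1, 1, 1, 27), (1, 1, 1, 81)]]),
   (21, [(8, 1, 1, 3), (3, 1, 1, 9), (3, 1, 1, 27), (3, 1, 1, 81), (1, 8, 16, 17), (1, 1, 1, 5),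
    (5, 5, 1, 41), (2, 3, 15, 241), (1, 1, 1, 31), (1, 9, 1, 271)], [[(3, 1, 1, 2), (8, 2, 1, 3),
    (1, 1, 1, 4), (1, 1, 1, 8), (1, 1, 1, 16), (2, 1, 1, 32), (2, 1, 1, 64), (8, 7, 1, 127), (1, 1,
    1, 128)], [(24, 2, 1, 9), (1, 1, 1, 2), (1, 1, 1, 16)], [(3, 1, 1, 2), (16, 3, 1, 7), (1, 1, 1,
    4), (1, 1, 1, 8), (1, 1, 1, 16), (1, 1, 1, 32), (1, 1, 1, 3)], [(3, 1, 1, 2), (8, 1, 1, 3), (1,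
    1, 1, 16), (2, 1, 1, 32), (16, 7, 1, 127), (1, 1, 1, 64)]], []),
   (23, [(24, 1, 1, 9), (1, 1, 1, 2)], [[(6, 1, 1, 4), (8, 3, 1, 7), (1, 1, 1, 8), (1, 1, 1, 16)],
    [(24, 1, 1, 16), (1, 1, 1, 3)]], [[(3, 1, 1, 2), (8, 1, 1, 3), (1, 1, 1, 9), (5, 1, 8, 41), (1,
    1, 1, 5), (27, 1, 3, 6481), (1, 1, 1, 81)]]),
   (25, [(8, 1, 1, 3), (27, 1, 1, 81), (1, 8, 16, 17), (1, 1, 1, 5), (5, 5, 1, 41), (1, 1, 5, 11),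
    (1, 27, 3, 271)], [[(3, 1, 1, 2), (16, 3, 1, 7), (1, 1, 1, 4), (1, 1, 1, 8), (1, 1, 1, 16), (1,
    1, 1, 32), (16, 7, 1, 127), (1, 1, 1, 64)], [(24, 1, 1, 16), (1, 1, 1, 3)], [(24, 1, 1, 9), (1,
    1, 1, 2), (1, 1, 1, 4), (1, 1, 1, 8), (1, 1, 1, 16)], [(24, 1, 1, 9), (1, 1, 1, 2), (1, 1, 1,
    4), (1, 1, 1, 8), (1, 1, 1, 16)]], []),
   (29, [(8, 1, 1, 3), (3, 1, 1, 9), (3, 1, 1, 27), (1, 8, 16, 17), (1, 1, 1, 5), (5, 5, 1, 41)],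
    [[(3, 1, 1, 2), (8, 2, 1, 3), (1, 1, 1, 4), (1, 1, 1, 8), (1, 1, 1, 16), (2, 1, 1, 32), (16, 7,
    1, 127), (1, 1, 1, 64)], [(24, 2, 1, 9), (1, 1, 1, 2), (1, 1, 1, 4), (1, 1, 1, 8)], [(24, 1, 1,
    9), (1, 1, 1, 2), (1, 1, 1, 4), (1, 1, 1, 8), (1, 4, 1, 5)]], []),
   (30, [(8, 1, 1, 3), (3, 1, 1, 9), (1, 4, 4, 5), (3, 2, 4, 17), (5, 5, 1, 41)], [[(96, 1, 1,
    64)], [(48, 1, 1, 32), (1, 1, 1, 3)]], []),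
   (32, [(12, 1, 1, 8)], [], [[(24, 1, 1, 9), (1, 1, 1, 2)], [(24, 1, 1, 9), (1, 1, 1, 4)], [(3,
    1, 1, 2), (2, 1, 1, 4), (2, 1, 1, 8), (2, 1, 1, 3), (3, 1, 16, 17), (1, 1, 1, 27), (1, 1, 1,
    5), (3, 1, 1, 81), (15, 1, 3, 6481)]]),
   (34, [(12, 1, 1, 8)], [], [[(3, 1, 1, 2), (8, 1, 1, 3), (1, 1, 1, 9), (3, 1, 16, 17), (1, 1, 1,
    27), (1, 1, 1, 5), (45, 1, 3, 6481), (1, 1, 1, 243)], [(24, 1, 1, 9), (1, 1, 1, 2), (1, 1, 1,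
    4)], [(72, 1, 1, 27), (1, 1, 1, 2)]]),
   (35, [(24, 1, 1, 9), (3, 1, 1, 27), (1, 8, 16, 17), (1, 1, 1, 5), (5, 5, 1, 41), (1, 1, 15,
    31), (1, 1, 1, 11)], [[(6, 1, 1, 4), (2, 1, 1, 8), (2, 1, 1, 16), (1, 2, 1, 3), (2, 1, 1, 32),
    (2, 1, 1, 64), (8, 7, 1, 127), (1, 1, 1, 128)], [(24, 1, 1, 16), (1, 1, 1, 3)], [(24, 1, 1, 9),
    (1, 1, 1, 4), (1, 1, 1, 8)]], []),
   (43, [(72, 1, 1, 27), (3, 1, 1, 81), (1, 8, 16, 17), (1, 1, 1, 5), (5, 5, 1, 41), (2, 3, 15,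
    241), (1, 1, 1, 31), (1, 9, 1, 271)], [[(6, 1, 1, 4), (2, 1, 1, 8), (2, 1, 1, 16), (1, 2, 1,
    3), (2, 1, 1, 32), (2, 1, 1, 64), (8, 7, 1, 127), (1, 1, 1, 128)], [(24, 1, 1, 16), (1, 1, 1,
    3)], [(24, 1, 1, 9), (1, 1, 1, 2), (1, 1, 1, 4), (1, 1, 1, 16)], [(24, 1, 1, 9), (1, 1, 1, 2),
    (1, 1, 1, 4), (1, 1, 1, 16)]], []),
   (44, [(24, 1, 1, 9), (1, 1, 1, 2)], [[(3, 1, 1, 2), (10, 5, 1, 31)], [(48, 1, 1, 32), (1, 1, 1,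
    3)]], [[(3, 1, 1, 2), (8, 1, 1, 3), (1, 1, 1, 9), (1, 1, 4, 5), (3, 1, 1, 27), (3, 1, 1, 81),
    (3, 1, 1, 243), (3, 1, 1, 729), (3, 1, 1, 2187), (3, 1, 1, 6561), (3, 1, 1, 19683), (3, 1, 1,
    59049), (3, 1, 1, 177147), (3, 1, 1, 531441), (2, 1, 81, 3889)]]),
   (46, [(24, 1, 1, 9), (1, 4, 4, 5), (3, 2, 4, 17), (1, 9, 9, 19)], [[(192, 1, 1, 128)], [(48, 1,
    1, 32), (1, 1, 1, 3)]], []),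
   (47, [(8, 1, 1, 3), (3, 1, 1, 9), (3, 1, 1, 27), (3, 1, 1, 81), (1, 8, 16, 17), (1, 1, 1, 5),
    (5, 5, 1, 41), (1, 3, 5, 61)], [[(6, 1, 1, 4), (4, 2, 1, 3), (1, 1, 1, 8), (1, 1, 1, 16)], [(6,
    1, 1, 4), (8, 3, 1, 7), (1, 1, 1, 8), (1, 1, 1, 32)], [(24, 1, 1, 9), (1, 1, 1, 2), (1, 1, 1,
    4), (1, 1, 1, 8)], [(24, 1, 1, 9), (1, 1, 1, 2), (1, 1, 1, 4), (1, 1, 1, 8)]], []),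
   (52, [(24, 1, 1, 9), (1, 1, 1, 2), (1, 1, 1, 4)], [[(3, 1, 1, 2), (2, 1, 1, 4), (4, 2, 1, 3),
    (1, 1, 1, 16), (1, 2, 1, 5), (3, 2, 1, 17), (1, 9, 1, 19), (2, 1, 1, 7), (5, 1, 1, 241), (8, 8,
    1, 641), (1, 1, 1, 256)], [(48, 1, 1, 32), (1, 1, 1, 3)]], [[(3, 1, 1, 2), (24, 1, 1, 27), (1,
    1, 16, 17), (1, 1, 1, 5), (3, 1, 1, 81), (15, 1, 3, 6481), (1, 1, 1, 243)], [(3, 1, 1, 2), (72,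
    1, 1, 81)]]),
   (53, [(24, 1, 1, 9), (3, 1, 1, 27), (3, 1, 1, 81), (1, 8, 16, 17), (1, 1, 1, 5), (1, 9, 27,
    109)], [[(3, 1, 1, 2), (16, 3, 1, 7), (1, 1, 1, 4), (1, 1, 1, 8), (1, 1, 1, 16), (1, 1, 1, 32),
    (1, 2, 1, 3), (2, 1, 1, 64), (8, 7, 1, 127), (1, 1, 1, 128)], [(24, 1, 1, 16), (1, 1, 1, 3)],
    [(24, 1, 1, 9), (1, 1, 1, 4), (1, 1, 1, 8)], [(24, 1, 1, 9), (1, 1, 1, 4), (1, 1, 1, 8)]], []),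
   (54, [(24, 1, 1, 16)], [], [[(24, 1, 1, 9), (1, 1, 1, 2)], [(24, 1, 1, 9), (1, 1, 1, 4)], [(12,
    1, 1, 8)], [(3, 1, 1, 2), (2, 1, 1, 4), (2, 1, 1, 8), (2, 1, 1, 3), (3, 1, 1, 27), (3, 1, 1,
    81), (3, 1, 1, 243), (3, 1, 1, 729), (3, 1, 1, 2187), (3, 1, 1, 6561), (3, 1, 1, 19683), (3, 1,
    1, 59049), (3, 1, 1, 177147), (3, 1, 1, 531441), (1, 1, 4, 5), (1, 1, 4, 17), (5, 1, 1, 41),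
    (1, 1, 3, 6481), (1, 1, 5, 271), (2, 1, 1, 241), (1, 1, 3, 1621), (1, 1, 81, 58321)]]),
   (57, [(8, 1, 1, 3), (1, 4, 4, 5)], [[(3, 1, 1, 2), (2, 1, 1, 4), (2, 1, 1, 8), (2, 1, 1, 16),
    (1, 2, 1, 3), (2, 1, 1, 32), (16, 7, 1, 127), (1, 1, 1, 128), (1, 1, 1, 512)]], []),
   (61, [(8, 1, 1, 3), (3, 1, 1, 9), (3, 1, 1, 27), (3, 1, 1, 81), (1, 8, 16, 17), (1, 1, 1, 5),
    (5, 5, 5, 11), (1, 1, 1, 41), (1, 3, 1, 61)], [[(3, 1, 1, 2), (2, 1, 1, 4), (2, 1, 1, 8), (2,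
    1, 1, 16), (1, 2, 1, 3), (2, 1, 1, 32), (16, 7, 1, 127), (1, 1, 1, 64), (1, 1, 1, 128)], [(24,
    1, 1, 16), (1, 1, 1, 3)], [(24, 1, 1, 9), (1, 1, 1, 2), (1, 1, 1, 4), (1, 1, 1, 8), (1, 1, 1,
    16)], [(24, 1, 1, 9), (1, 1, 1, 2), (1, 1, 1, 4), (1, 1, 1, 8), (1, 1, 1, 16)]], []),
   (62, [(24, 1, 1, 9), (1, 4, 4, 5), (3, 2, 4, 17), (5, 5, 1, 41), (1, 3, 5, 61), (1, 1, 1, 11)],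
    [[(3, 1, 1, 2), (128, 1, 1, 256)], [(3, 1, 1, 2), (128, 1, 1, 256)]], []),
   (63, [(3, 1, 1, 2), (8, 1, 1, 3), (1, 4, 4, 5), (5, 5, 2, 41), (3, 2, 2, 17)], [[(6, 1, 1, 4),
    (2, 1, 1, 8), (2, 1, 1, 16), (1, 2, 1, 3), (2, 1, 1, 32), (2, 1, 1, 64), (8, 7, 1, 127), (1, 1,
    1, 128), (1, 1, 1, 256)]], [[(3, 1, 1, 2), (8, 1, 1, 3), (3, 1, 1, 27), (3, 1, 1, 81), (3, 1,
    42, 2269), (1, 1, 1, 243)]]),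
   (68, [(24, 1, 1, 9), (3, 1, 1, 27), (1, 8, 16, 17), (1, 1, 1, 5), (1, 9, 9, 19)], [[(3, 1, 1,
    2), (2, 1, 1, 4), (4, 2, 1, 3), (1, 1, 1, 16), (1, 2, 1, 5), (32, 7, 1, 127), (1, 1, 1, 128)],
    [(24, 2, 1, 9), (1, 1, 1, 2), (1, 1, 1, 4)], [(48, 1, 1, 32), (1, 1, 1, 3)]], []),
   (69, [(8, 1, 1, 3), (3, 1, 1, 9), (3, 1, 1, 27), (1, 8, 16, 17), (1, 1, 1, 5), (5, 5, 1, 41),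
    (2, 3, 15, 241), (1, 1, 1, 7)], [[(30, 5, 1, 31), (1, 1, 1, 4)], [(3, 1, 1, 2), (8, 1, 1, 3),
    (1, 1, 1, 16), (1, 2, 1, 9), (2, 1, 1, 32), (16, 7, 1, 127), (1, 1, 1, 128), (1, 1, 1, 256)],
    [(24, 1, 1, 9), (1, 1, 1, 16)]], []),
   (70, [(72, 1, 1, 27), (1, 1, 1, 2)], [[(24, 1, 1, 16)], [(24, 1, 1, 16)], [(24, 1, 1, 9), (1,
    1, 1, 2), (1, 1, 1, 16)]], [[(3, 1, 1, 2), (24, 1, 1, 27), (5, 1, 8, 41), (1, 1, 1, 5), (9, 1,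
    3, 6481), (1, 1, 1, 243)]]),
   (78, [(24, 1, 1, 9), (1, 1, 1, 2)], [[(96, 1, 1, 64)], [(96, 1, 1, 64)]], [[(3, 1, 1, 2), (8,
    1, 1, 3), (1, 1, 1, 9), (3, 1, 1, 27), (3, 1, 1, 81), (3, 1, 42, 2269), (1, 1, 1, 243)]]),
   (79, [(6, 1, 1, 4), (2, 4, 4, 5), (1, 1, 1, 8)], [], [[(3, 1, 1, 2), (8, 1, 1, 3), (1, 1, 1,
    9), (1, 1, 4, 5), (2, 1, 3, 7), (27, 1, 7, 2269), (1, 1, 1, 243)], [(72, 1, 1, 27), (1, 1, 1,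
    2), (1, 1, 1, 4), (1, 1, 4, 5)], [(6, 1, 1, 4), (2, 1, 1, 8), (2, 1, 1, 3), (3, 1, 1, 27), (3,
    1, 1, 81), (3, 1, 1, 243), (1, 1, 42, 2269)]]),
   (89, [(24, 1, 1, 9), (3, 1, 1, 27), (1, 8, 16, 17), (1, 1, 1, 5), (2, 3, 3, 7)], [[(3, 1, 1,
    2), (8, 2, 1, 3), (1, 1, 1, 4), (1, 1, 1, 8), (1, 1, 1, 16)], [(3, 1, 1, 2), (8, 2, 1, 9), (1,
    1, 1, 4), (1, 1, 1, 8), (2, 1, 1, 32), (16, 7, 1, 127), (1, 1, 1, 64)], [(24, 1, 1, 9), (1, 1,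
    1, 4), (2, 1, 1, 32), (2, 1, 1, 64), (8, 7, 1, 127)]], []),
   (93, [(8, 1, 1, 3), (3, 1, 1, 9), (3, 1, 1, 27), (3, 1, 1, 81), (1, 8, 16, 17), (1, 1, 1, 5),
    (1, 9, 27, 109)], [[(3, 1, 1, 2), (8, 2, 1, 3), (1, 1, 1, 4), (1, 1, 1, 8), (1, 1, 1, 16), (2,
    1, 1, 32), (2, 1, 1, 64), (8, 7, 1, 127), (1, 1, 1, 128), (1, 1, 1, 256)], [(3, 1, 1, 2), (8,
    1, 1, 3), (1, 1, 1, 16), (1, 2, 1, 9), (2, 1, 1, 32), (16, 7, 1, 127), (1, 1, 1, 64), (1, 1, 1,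
    128), (1, 1, 1, 256)], [(24, 1, 1, 9), (1, 1, 1, 16)], [(24, 1, 1, 9), (1, 1, 1, 16)]], []),
   (94, [(24, 1, 1, 9), (1, 1, 1, 4)], [[(96, 1, 1, 64)], [(96, 1, 1, 64)]], [[(24, 1, 1, 9), (1,
    1, 1, 2)], [(3, 1, 1, 2), (2, 1, 1, 4), (2, 1, 4, 5), (2, 1, 1, 3), (3, 1, 1, 27), (3, 1, 1,
    81), (3, 1, 1, 243), (3, 1, 1, 729), (3, 1, 1, 2187), (3, 1, 1, 6561), (3, 1, 1, 19683), (3, 1,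
    1, 59049), (3, 1, 1, 177147), (3, 1, 1, 531441), (1, 1, 4, 17), (5, 1, 1, 41), (1, 1, 3, 6481),
    (1, 1, 5, 271), (2, 1, 1, 241), (1, 1, 3, 1621), (1, 1, 81, 58321)]]),
   (97, [(72, 1, 1, 27), (3, 1, 1, 81), (1, 8, 16, 17), (1, 1, 1, 5), (5, 5, 1, 41), (1, 1, 5,
    11), (1, 27, 3, 271)], [[(30, 5, 1, 31), (1, 1, 1, 2), (1, 1, 1, 4)], [(24, 2, 1, 9), (1, 1, 1,
    2), (1, 1, 1, 4), (2, 1, 1, 32), (2, 1, 1, 64), (8, 7, 1, 127), (1, 1, 1, 128)], [(3, 1, 1, 2),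
    (8, 1, 1, 3), (1, 1, 1, 4), (1, 1, 1, 8), (1, 1, 1, 9), (2, 1, 1, 32), (16, 7, 1, 127), (1, 1,
    1, 128), (1, 1, 1, 512)], [(72, 1, 1, 27), (1, 1, 1, 4), (1, 1, 1, 8)]], []),
   (110, [(8, 1, 1, 3), (27, 1, 1, 81), (3, 1, 1, 243), (1, 8, 16, 17), (1, 1, 1, 5), (5, 5, 1,
    41), (1, 3, 5, 61), (1, 27, 3, 6481)], [[(3, 1, 1, 2), (2, 1, 1, 4), (2, 1, 1, 8), (1, 4, 1,
    5), (2, 1, 1, 3), (32, 7, 1, 127), (1, 1, 1, 256), (1, 1, 1, 512)], [(24, 2, 1, 9), (1, 1, 1,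
    2), (1, 1, 1, 4)], [(48, 1, 1, 32), (1, 1, 1, 3)], [(48, 1, 1, 32), (1, 1, 1, 3)], [(48, 1, 1,
    32), (1, 1, 1, 3)]], []),
   (115, [(8, 1, 1, 3), (3, 1, 1, 9), (3, 1, 1, 27), (3, 1, 1, 81), (3, 1, 1, 243), (1, 8, 16,
    17), (1, 1, 1, 5), (1, 9, 27, 109), (1, 1, 1, 19)], [[(6, 1, 1, 4), (4, 2, 1, 3), (1, 1, 1, 8),
    (1, 1, 1, 16)], [(24, 2, 1, 9), (1, 1, 1, 2), (1, 1, 1, 4), (1, 1, 1, 8)], [(6, 1, 1, 4), (2,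
    1, 1, 8), (2, 1, 1, 3), (2, 1, 1, 32), (3, 18, 1, 19), (1, 1, 1, 27), (1, 1, 1, 7)], [(6, 1, 1,
    4), (8, 3, 1, 7), (1, 1, 1, 8), (1, 1, 1, 16)], [(6, 1, 1, 4), (5, 5, 1, 31)]], []),
   (125, [(24, 1, 1, 9), (3, 1, 1, 27), (3, 1, 1, 81), (3, 1, 1, 243), (1, 8, 16, 17), (1, 1, 1,
    5), (5, 5, 1, 41), (1, 3, 5, 61), (1, 1, 1, 11), (1, 27, 3, 6481)], [[(3, 1, 1, 2), (8, 2, 1,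
    3), (1, 1, 1, 4), (1, 1, 1, 8), (1, 1, 1, 16), (2, 1, 1, 32), (16, 7, 1, 127), (1, 1, 1, 256)],
    [(24, 1, 1, 16), (1, 1, 1, 3), (1, 2, 1, 9), (2, 1, 1, 32), (2, 1, 1, 64), (8, 7, 1, 127)],
    [(24, 1, 1, 9), (1, 1, 1, 4), (1, 1, 1, 8)], [(24, 1, 1, 9), (1, 1, 1, 4), (1, 1, 1, 8)], [(24,
    1, 1, 9), (1, 1, 1, 4), (1, 1, 1, 8)]], []),
   (126, [(8, 1, 1, 3), (3, 1, 1, 9), (3, 1, 1, 27), (1, 8, 16, 17), (1, 1, 1, 5), (5, 5, 1, 41),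
    (2, 3, 15, 241), (1, 1, 1, 31), (1, 3, 3, 181)], [[(3, 1, 1, 2), (128, 1, 1, 256)], [(24, 2, 1,
    9), (1, 1, 1, 2)], [(48, 1, 1, 32), (1, 1, 1, 3)]], []),
   (127, [(24, 1, 1, 9), (3, 1, 1, 27), (3, 1, 1, 81), (3, 1, 1, 243), (1, 8, 16, 17), (1, 1, 1,
    5), (5, 5, 1, 41), (1, 1, 5, 11), (2, 3, 3, 241), (1, 1, 1, 31), (1, 27, 1, 6481)], [[(6, 1, 1,
    4), (2, 1, 1, 8), (2, 1, 1, 16), (1, 2, 1, 3), (2, 1, 1, 32), (2, 1, 1, 64), (8, 7, 1, 127),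
    (1, 1, 1, 256)], [(24, 1, 1, 16), (1, 1, 1, 3)], [(24, 1, 1, 9), (1, 1, 1, 4), (1, 1, 1, 16)],
    [(24, 1, 1, 9), (1, 1, 1, 4), (1, 1, 1, 16)], [(24, 1, 1, 9), (1, 1, 1, 4), (1, 1, 1, 16)]],
    []),
   (133, [(8, 1, 1, 3), (27, 1, 1, 81), (3, 1, 1, 243), (1, 8, 16, 17), (1, 1, 1, 5), (5, 5, 5,
    11), (1, 1, 1, 41), (2, 3, 3, 241), (1, 1, 1, 31), (1, 27, 1, 6481)], [[(3, 1, 1, 2), (8, 2, 1,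
    3), (1, 1, 1, 4), (1, 1, 1, 8), (1, 1, 1, 16), (2, 1, 1, 32), (16, 7, 1, 127), (1, 1, 1, 64),
    (1, 1, 1, 512)], [(24, 2, 1, 9), (1, 1, 1, 2), (1, 1, 1, 4), (1, 1, 1, 8)], [(24, 1, 1, 9), (1,
    1, 1, 2), (1, 1, 1, 4), (1, 1, 1, 8), (2, 3, 1, 7), (1, 1, 1, 32)], [(24, 1, 1, 9), (1, 1, 1,
    2), (1, 1, 1, 4), (1, 1, 1, 8), (3, 8, 1, 17)], [(24, 1, 1, 9), (1, 1, 1, 2), (1, 1, 1, 4), (1,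
    1, 1, 8), (2, 3, 1, 7), (1, 1, 1, 32)]], []),
   (140, [(24, 1, 1, 9), (3, 1, 1, 27), (3, 1, 1, 81), (1, 8, 16, 17), (1, 1, 1, 5), (5, 5, 1,
    41), (2, 3, 15, 241), (1, 1, 1, 7), (1, 1, 1, 31), (1, 9, 1, 271)], [[(3, 1, 1, 2), (2, 1, 1,
    4), (4, 2, 1, 3), (1, 1, 1, 16), (1, 2, 1, 5), (3, 2, 1, 17), (2, 3, 1, 7), (4, 16, 1, 769),
    (1, 1, 1, 128)], [(24, 2, 1, 9), (1, 1, 1, 2), (1, 1, 1, 4)], [(48, 1, 1, 32), (1, 1, 1, 3)],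
    [(48, 1, 1, 32), (1, 1, 1, 3)]], []),
   (181, [(24, 1, 1, 9), (1, 4, 4, 5), (5, 5, 2, 41), (1, 1, 15, 31), (1, 1, 1, 11)], [[(3, 1, 1,
    2), (8, 2, 1, 3), (1, 1, 1, 4), (1, 1, 1, 8), (1, 1, 1, 16), (2, 1, 1, 32), (2, 1, 1, 64), (2,
    1, 1, 128), (2, 1, 1, 256), (2, 1, 1, 512), (2, 1, 1, 1024), (2, 1, 1, 2048), (2, 1, 1, 4096),
    (2, 1, 1, 8192), (2, 1, 1, 16384), (2, 1, 1, 32768), (2, 1, 1, 65536), (2, 1, 1, 131072), (2,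
    1, 1, 262144), (2, 1, 1, 524288), (2, 1, 1, 1048576), (1, 2, 1, 5), (1, 3, 1, 7), (3, 2, 1,
    17), (1, 3, 1, 19), (3, 1, 1, 109), (5, 1, 1, 241), (1, 8, 1, 641), (1, 32, 1, 12289)], [(24,
    1, 1, 16), (1, 1, 1, 3), (1, 2, 1, 9), (2, 1, 1, 32), (2, 1, 1, 64), (8, 7, 1, 127), (1, 1, 1,
    128)]], []),
   (185, [(24, 1, 1, 9), (1, 4, 4, 5), (3, 9, 9, 19)], [[(3, 1, 1, 2), (8, 2, 1, 3), (1, 1, 1, 4),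
    (1, 1, 1, 8), (1, 1, 1, 16)], [(3, 1, 1, 2), (2, 1, 1, 4), (2, 1, 1, 8), (2, 1, 1, 3), (1, 2,
    1, 9), (2, 1, 1, 32), (16, 7, 1, 127), (1, 1, 1, 64), (1, 1, 1, 128), (1, 1, 1, 256)]], []),
   (190, [(24, 1, 1, 9), (1, 4, 4, 5), (5, 5, 2, 41), (1, 3, 5, 61), (1, 1, 1, 11)], [[(3, 1, 1,
    2), (2, 1, 1, 4), (2, 1, 1, 8), (1, 4, 1, 5), (2, 1, 1, 3), (2, 1, 1, 32), (1, 3, 1, 7), (5, 2,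
    1, 241), (1, 5, 1, 61), (5, 1, 1, 151), (1, 5, 1, 1201), (3, 1, 1, 1801), (32, 3, 1, 115201),
    (1, 1, 1, 1024)], [(192, 1, 1, 128), (1, 1, 1, 3)]], []),
   (209, [(8, 1, 1, 3), (3, 1, 1, 9), (3, 1, 1, 27), (3, 1, 1, 81), (1, 8, 16, 17), (1, 1, 1, 5),
    (5, 5, 1, 41)], [[(3, 1, 1, 2), (16, 3, 1, 7), (1, 1, 1, 4), (1, 1, 1, 8), (1, 1, 1, 16), (1,
    1, 1, 32), (16, 7, 1, 127), (1, 1, 1, 64), (1, 1, 1, 128), (1, 1, 1, 512)], [(24, 1, 1, 16),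
    (1, 1, 1, 3)], [(24, 1, 1, 9), (1, 1, 1, 2), (1, 1, 1, 4), (1, 1, 1, 8), (1, 1, 1, 16)], [(24,
    1, 1, 9), (1, 1, 1, 2), (1, 1, 1, 4), (1, 1, 1, 8), (1, 1, 1, 16)]], []),
   (212, [(24, 1, 1, 9), (3, 1, 1, 27), (3, 1, 1, 81), (1, 8, 16, 17), (1, 1, 1, 5), (5, 5, 1,
    41), (2, 3, 15, 241), (1, 1, 1, 31), (1, 9, 1, 271)], [[(3, 1, 1, 2), (10, 5, 1, 31)], [(24, 2,
    1, 9), (1, 1, 1, 2), (1, 1, 1, 4)], [(3, 1, 1, 2), (2, 1, 1, 4), (4, 1, 1, 3), (1, 1, 1, 16),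
    (1, 4, 1, 5), (3, 1, 1, 27), (1, 2, 1, 17), (2, 3, 1, 7), (4, 16, 1, 769), (1, 1, 1, 64)], [(3,
    1, 1, 2), (2, 1, 1, 4), (4, 1, 1, 3), (1, 1, 1, 16), (3, 8, 1, 17)]], []),
   (214, [(24, 1, 1, 16)], [], [[(3, 1, 1, 2), (24, 1, 1, 27), (1, 1, 4, 5), (3, 1, 1, 81), (3, 1,
    1, 243), (3, 1, 1, 729), (3, 1, 1, 2187), (3, 1, 1, 6561), (3, 1, 1, 19683), (3, 1, 1, 59049),
    (3, 1, 1, 177147), (3, 1, 1, 531441), (2, 1, 81, 3889)], [(24, 1, 1, 9), (1, 1, 1, 2), (1, 1,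
    1, 4)], [(12, 1, 1, 8)], [(3, 1, 1, 2), (72, 1, 1, 81)]]),
   (241, [(3, 1, 1, 2), (24, 1, 1, 27), (1, 8, 16, 17), (1, 1, 1, 5), (2, 3, 3, 7)], [[(36, 8, 1,
    17), (1, 1, 1, 2), (1, 1, 1, 4), (1, 1, 1, 8), (1, 1, 1, 5)], [(24, 2, 1, 9), (1, 1, 1, 2), (1,
    1, 1, 4), (1, 2, 1, 5)], [(3, 1, 1, 2), (8, 1, 1, 3), (1, 1, 1, 4), (1, 1, 1, 8), (1, 1, 1, 9),
    (2, 1, 1, 32), (16, 7, 1, 127), (1, 1, 1, 64), (1, 1, 1, 128)]], [[(3, 1, 1, 2), (8, 1, 1, 3),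
    (1, 1, 1, 9), (81, 1, 1, 729)]]),
   (254, [(72, 1, 1, 27), (1, 1, 1, 2)], [[(3, 1, 1, 2), (2, 1, 1, 4), (256, 1, 1, 1024)], [(24,
    2, 1, 9), (1, 1, 1, 2), (1, 1, 1, 4)], [(192, 1, 1, 128), (1, 1, 1, 3)]], [[(3, 1, 1, 2), (24,
    1, 1, 27), (1, 1, 4, 5), (3, 1, 1, 81), (3, 1, 1, 243), (3, 1, 1, 729), (3, 1, 1, 2187), (3, 1,
    1, 6561), (3, 1, 1, 19683), (3, 1, 1, 59049), (3, 1, 1, 177147), (3, 1, 1, 531441), (2, 1, 81,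
    3889)]]),
   (277, [(8, 1, 1, 3), (3, 1, 1, 9), (3, 1, 1, 27), (3, 1, 1, 81), (3, 1, 1, 243), (1, 8, 16,
    17), (1, 1, 1, 5), (1, 9, 27, 109), (1, 1, 1, 19), (2, 1, 1, 7)], [[(36, 8, 1, 17), (1, 1, 1,
    2), (1, 1, 1, 4), (1, 1, 1, 8), (1, 1, 1, 5)], [(24, 2, 1, 9), (1, 1, 1, 2), (1, 1, 1, 4), (1,
    1, 1, 8)], [(24, 1, 1, 9), (1, 1, 1, 2), (1, 1, 1, 4), (1, 1, 1, 8), (2, 1, 1, 32), (2, 1, 1,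
    64), (8, 7, 1, 127)], [(24, 1, 1, 9), (1, 1, 1, 2), (1, 1, 1, 4), (1, 1, 1, 8), (2, 3, 1, 7)],
    [(24, 1, 1, 9), (1, 1, 1, 2), (1, 1, 1, 4), (1, 1, 1, 8), (3, 8, 1, 17), (1, 1, 1, 27)]], []),
   (287, [(6, 1, 1, 4), (4, 1, 1, 3), (1, 1, 1, 9), (3, 1, 1, 27), (1, 8, 16, 17), (1, 1, 1, 5),
    (7, 3, 3, 13)], [[(6, 1, 1, 4), (4, 2, 1, 3), (1, 1, 1, 8), (1, 1, 1, 16)], [(24, 2, 1, 9), (1,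
    1, 1, 2), (1, 1, 1, 4), (1, 1, 1, 8)], [(6, 1, 1, 4), (2, 1, 1, 8), (2, 1, 1, 3), (2, 1, 1,
    32), (2, 1, 1, 64), (2, 1, 1, 128), (2, 1, 1, 256), (2, 1, 1, 512), (2, 1, 1, 1024), (2, 1, 1,
    2048), (2, 1, 1, 4096), (2, 1, 1, 8192), (2, 1, 1, 16384), (2, 1, 1, 32768), (2, 1, 1, 65536),
    (2, 1, 1, 131072), (2, 1, 1, 262144), (2, 1, 1, 524288), (2, 1, 1, 1048576), (7, 28, 1, 29),
    (1, 1, 1, 5), (1, 1, 1, 127)]], [[(24, 1, 1, 9), (1, 1, 1, 2)], [(24, 1, 1, 9), (1, 1, 1, 4),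
    (3, 1, 1, 27), (3, 1, 1, 81), (3, 1, 1, 243), (3, 1, 1, 729), (3, 1, 1, 2187), (3, 1, 1, 6561),
    (3, 1, 1, 19683), (3, 1, 1, 59049), (3, 1, 1, 177147), (3, 1, 1, 531441), (2, 1, 81, 3889)]]),
   (309, [(8, 1, 1, 3), (3, 1, 1, 9), (3, 1, 1, 27), (3, 1, 1, 81), (1, 8, 16, 17), (1, 1, 1, 5),
    (5, 5, 1, 41), (2, 3, 15, 241), (1, 1, 1, 31), (1, 9, 1, 271)], [[(36, 8, 1, 17), (1, 1, 1, 2),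
    (1, 1, 1, 4), (1, 1, 1, 8), (1, 1, 1, 5)], [(24, 2, 1, 9), (1, 1, 1, 2), (1, 1, 1, 16)], [(3,
    1, 1, 2), (8, 1, 1, 3), (1, 1, 1, 16), (2, 1, 1, 32), (2, 1, 1, 64), (2, 1, 1, 128), (2, 1, 1,
    256), (2, 1, 1, 512), (2, 1, 1, 1024), (2, 1, 1, 2048), (2, 1, 1, 4096), (2, 1, 1, 8192), (2,
    1, 1, 16384), (2, 1, 1, 32768), (2, 1, 1, 65536), (2, 1, 1, 131072), (2, 1, 1, 262144), (2, 1,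
    1, 524288), (2, 1, 1, 1048576), (7, 28, 1, 29), (1, 1, 1, 5), (1, 1, 1, 127)], [(3, 1, 1, 2),
    (16, 3, 1, 7), (1, 1, 1, 4), (1, 1, 1, 8), (1, 1, 1, 16), (1, 1, 1, 32), (1, 1, 1, 3)]], []),
   (313, [(3, 1, 1, 2), (2, 1, 1, 4), (2, 1, 1, 8), (2, 1, 1, 3), (1, 4, 4, 5), (5, 5, 2, 41), (1,
    3, 5, 61), (1, 1, 1, 11)], [[(3, 1, 1, 2), (4, 4, 1, 5), (1, 1, 1, 4), (1, 1, 1, 8), (2, 1, 1,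
    3), (2, 1, 1, 32), (2, 1, 1, 64), (2, 1, 1, 128), (2, 1, 1, 256), (2, 1, 1, 512), (2, 1, 1,
    1024), (2, 1, 1, 2048), (2, 1, 1, 4096), (2, 1, 1, 8192), (2, 1, 1, 16384), (2, 1, 1, 32768),
    (2, 1, 1, 65536), (2, 1, 1, 131072), (2, 1, 1, 262144), (2, 1, 1, 524288), (2, 1, 1, 1048576),
    (1, 3, 1, 7), (3, 2, 1, 17), (1, 3, 1, 19), (3, 1, 1, 109), (5, 1, 1, 241), (5, 25, 1,
    115201)]], [[(72, 1, 1, 27), (1, 1, 1, 2)], [(6, 1, 1, 4), (10, 1, 10, 61), (1, 1, 1, 11)],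
    [(24, 1, 1, 9), (1, 1, 1, 2), (1, 1, 1, 4), (1, 1, 1, 8), (3, 1, 1, 27), (3, 1, 1, 81), (3, 1,
    1, 243), (1, 1, 42, 2269)]]),
   (317, [(8, 1, 1, 3), (3, 1, 1, 9), (3, 1, 1, 27), (3, 1, 1, 81), (3, 1, 1, 243), (3, 1, 1,
    729), (1, 8, 16, 17), (1, 1, 1, 5), (1, 9, 27, 109), (1, 1, 1, 19), (2, 9, 3, 3889)], [[(30, 5,
    1, 31), (1, 1, 1, 4)], [(24, 2, 1, 9), (1, 1, 1, 2), (1, 1, 1, 4), (1, 1, 1, 8)], [(24, 1, 1,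
    9), (1, 1, 1, 2), (1, 1, 1, 4), (1, 1, 1, 8), (2, 1, 1, 32), (2, 1, 1, 64), (8, 7, 1, 127)],
    [(24, 1, 1, 9), (1, 1, 1, 2), (1, 1, 1, 4), (1, 1, 1, 8), (2, 3, 1, 7), (1, 1, 1, 32)], [(24,
    1, 1, 9), (1, 1, 1, 2), (1, 1, 1, 4), (1, 1, 1, 8), (3, 8, 1, 17), (1, 1, 1, 27)], [(24, 1, 1,
    9), (1, 1, 1, 2), (1, 1, 1, 4), (1, 1, 1, 8), (2, 3, 1, 7), (1, 1, 1, 32)]], []),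
   (366, [(8, 1, 1, 3), (3, 1, 1, 9), (1, 4, 4, 5), (3, 9, 9, 19)], [[(3, 1, 1, 2), (16, 3, 1, 7),
    (1, 1, 1, 4), (1, 1, 1, 32)], [(3, 1, 1, 2), (2, 1, 1, 4), (2, 1, 1, 8), (2, 1, 1, 3), (1, 2,
    1, 9), (1, 2, 1, 5), (2, 1, 1, 32), (1, 3, 1, 7), (5, 2, 1, 241), (8, 8, 1, 641), (1, 1, 1,
    256), (1, 2, 1, 769), (1, 5, 1, 61), (1, 5, 1, 1601), (5, 1, 1, 25601), (3, 1, 1, 57601), (16,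
    6, 1, 921601), (1, 1, 1, 4096)]], []),
   (377, [(24, 1, 1, 9), (3, 1, 1, 27), (1, 8, 16, 17), (1, 1, 1, 5), (1, 9, 9, 19)], [[(36, 8, 1,
    17), (1, 1, 1, 2), (1, 1, 1, 4), (1, 1, 1, 8), (1, 1, 1, 5)], [(3, 1, 1, 2), (8, 2, 1, 9), (1,
    1, 1, 4), (1, 1, 1, 8), (2, 1, 1, 32), (16, 7, 1, 127), (1, 1, 1, 64), (1, 1, 1, 256)], [(24,
    1, 1, 9), (1, 1, 1, 4), (2, 1, 1, 32), (2, 1, 1, 64), (8, 7, 1, 127), (1, 1, 1, 128)]], []),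
   (385, [(8, 1, 1, 3), (3, 1, 1, 9), (3, 1, 1, 27), (3, 1, 1, 81), (3, 1, 1, 243), (1, 8, 16,
    17), (1, 1, 1, 5), (1, 9, 27, 109), (1, 1, 1, 19), (10, 1, 5, 241), (1, 1, 1, 7)], [[(36, 8, 1,
    17), (1, 1, 1, 2), (1, 1, 1, 4), (1, 1, 1, 8), (1, 1, 1, 5)], [(24, 2, 1, 9), (1, 1, 1, 2), (1,
    1, 1, 4), (2, 1, 1, 32), (2, 1, 1, 64), (8, 7, 1, 127), (1, 1, 1, 256)], [(72, 2, 1, 27), (1,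
    1, 1, 2), (1, 1, 1, 4), (1, 1, 1, 8)], [(3, 1, 1, 2), (16, 3, 1, 7), (1, 1, 1, 4), (1, 1, 1,
    8), (1, 1, 1, 16), (1, 1, 1, 32), (1, 1, 1, 9)], [(3, 1, 1, 2), (8, 1, 1, 3), (1, 1, 1, 4), (1,
    1, 1, 8), (1, 1, 1, 9), (2, 1, 1, 32), (16, 7, 1, 127), (1, 1, 1, 64)]], []),
   (425, [(8, 1, 1, 3), (3, 1, 1, 9), (3, 1, 1, 27), (3, 1, 1, 81), (3, 1, 1, 243), (3, 1, 1,
    729), (1, 8, 16, 17), (1, 1, 1, 5), (5, 5, 1, 41), (1, 1, 5, 11), (2, 3, 3, 241), (1, 1, 1,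
    31), (1, 27, 1, 6481)], [[(36, 8, 1, 17), (1, 1, 1, 2), (1, 1, 1, 4), (1, 1, 1, 8), (1, 1, 1,
    5)], [(24, 2, 1, 9), (1, 1, 1, 2), (1, 1, 1, 4), (1, 2, 1, 5)], [(72, 2, 1, 27), (1, 1, 1, 2),
    (1, 1, 1, 4), (1, 1, 1, 8)], [(3, 1, 1, 2), (8, 1, 1, 3), (1, 1, 1, 4), (1, 1, 1, 8), (1, 1, 1,
    9), (2, 1, 1, 32), (16, 7, 1, 127), (1, 1, 1, 64), (1, 1, 1, 128)], [(3, 1, 1, 2), (16, 3, 1,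
    7), (1, 1, 1, 4), (1, 1, 1, 8), (1, 1, 1, 16), (1, 1, 1, 32), (1, 1, 1, 9)], [(3, 1, 1, 2), (8,
    1, 1, 3), (1, 1, 1, 4), (1, 1, 1, 8), (1, 1, 1, 9), (2, 1, 1, 32), (16, 7, 1, 127), (1, 1, 1,
    128)]], []),
   (453, [(8, 1, 1, 3), (3, 1, 1, 9), (3, 1, 1, 27), (3, 1, 1, 81), (3, 1, 1, 243), (1, 8, 16,
    17), (1, 1, 1, 5), (5, 5, 1, 41), (1, 3, 5, 61), (1, 27, 3, 6481)], [[(36, 8, 1, 17), (1, 1, 1,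
    2), (1, 1, 1, 4), (1, 1, 1, 8), (1, 1, 1, 5)], [(24, 2, 1, 9), (1, 1, 1, 2), (1, 1, 1, 16)],
    [(3, 1, 1, 2), (8, 1, 1, 3), (1, 1, 1, 16), (2, 1, 1, 32), (16, 7, 1, 127), (1, 1, 1, 128)],
    [(16, 3, 1, 7), (1, 1, 1, 3)], [(3, 1, 1, 2), (8, 1, 1, 3), (1, 1, 1, 16), (2, 1, 1, 32), (3,
    18, 1, 19), (1, 1, 1, 27), (1, 1, 1, 7)]], []),
   (483, [(6, 1, 1, 4), (4, 1, 1, 3)], [[(6, 1, 1, 4), (2, 1, 1, 8), (2, 1, 1, 16), (1, 2, 1, 3),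
    (2, 1, 1, 32), (2, 1, 1, 64), (2, 1, 1, 128), (2, 1, 1, 256), (2, 1, 1, 512), (2, 1, 1, 1024),
    (2, 1, 1, 2048), (2, 1, 1, 4096), (2, 1, 1, 8192), (2, 1, 1, 16384), (2, 1, 1, 32768), (2, 1,
    1, 65536), (2, 1, 1, 131072), (2, 1, 1, 262144), (2, 1, 1, 524288), (2, 1, 1, 1048576), (1, 2,
    1, 5), (1, 3, 1, 7), (3, 2, 1, 17), (1, 3, 1, 19), (3, 1, 1, 109), (5, 1, 1, 241), (5, 25, 1,
    115201)]], [[(24, 1, 1, 9), (1, 1, 1, 2)], [(3, 1, 1, 2), (8, 1, 1, 3), (1, 1, 1, 9), (3, 1, 1,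
    27), (3, 1, 1, 81), (3, 1, 1, 243), (3, 1, 1, 729), (3, 1, 1, 2187), (3, 1, 1, 6561), (3, 1, 1,
    19683), (3, 1, 1, 59049), (3, 1, 1, 177147), (3, 1, 1, 531441), (2, 1, 81, 3889)]]),
   (525, [(8, 1, 1, 3), (3, 1, 1, 9), (3, 1, 1, 27), (3, 1, 1, 81), (3, 1, 1, 243), (1, 8, 16,
    17), (1, 1, 1, 5), (5, 5, 5, 11), (1, 1, 1, 41), (2, 3, 3, 241), (1, 1, 1, 7), (1, 1, 1, 31),
    (1, 27, 1, 6481)], [[(3, 1, 1, 2), (8, 2, 1, 3), (1, 1, 1, 4), (1, 1, 1, 8), (1, 1, 1, 16), (2,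
    1, 1, 32), (2, 1, 1, 64), (2, 1, 1, 128), (2, 1, 1, 256), (2, 1, 1, 512), (2, 1, 1, 1024), (2,
    1, 1, 2048), (2, 1, 1, 4096), (2, 1, 1, 8192), (2, 1, 1, 16384), (2, 1, 1, 32768), (2, 1, 1,
    65536), (2, 1, 1, 131072), (2, 1, 1, 262144), (2, 1, 1, 524288), (2, 1, 1, 1048576), (1, 2, 1,
    5), (1, 3, 1, 7), (3, 2, 1, 17), (1, 3, 1, 19), (3, 1, 1, 109), (5, 1, 1, 241), (1, 8, 1, 641),
    (7, 10, 1, 286721)], [(30, 5, 1, 31), (1, 1, 1, 2)], [(24, 1, 1, 9), (1, 1, 1, 16)], [(24, 1,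
    1, 9), (1, 1, 1, 16)], [(24, 1, 1, 9), (1, 1, 1, 16)]], []),
   (569, [(8, 1, 1, 3), (3, 1, 1, 9), (3, 1, 1, 27), (1, 8, 16, 17), (1, 1, 1, 5), (5, 5, 1, 41),
    (1, 3, 5, 61), (1, 1, 1, 11)], [[(30, 5, 1, 31)], [(24, 2, 1, 9), (1, 1, 1, 2), (1, 1, 1, 4),
    (2, 1, 1, 32), (2, 1, 1, 64), (8, 7, 1, 127), (1, 1, 1, 128), (1, 1, 1, 512)], [(3, 1, 1, 2),
    (8, 1, 1, 3), (1, 1, 1, 4), (1, 1, 1, 8), (1, 1, 1, 9), (2, 1, 1, 32), (16, 7, 1, 127), (1, 1,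
    1, 128)]], []),
   (572, [(24, 1, 1, 9), (3, 1, 1, 27), (3, 1, 1, 81), (3, 1, 1, 243), (1, 8, 16, 17), (1, 1, 1,
    5), (5, 5, 1, 41), (1, 3, 5, 61), (1, 27, 3, 6481)], [[(3, 1, 1, 2), (10, 5, 1, 31), (1, 1, 1,
    4)], [(24, 2, 1, 9), (1, 1, 1, 2), (1, 1, 1, 4)], [(3, 1, 1, 2), (2, 1, 1, 4), (4, 1, 1, 3),
    (1, 1, 1, 16), (1, 4, 1, 5), (3, 1, 1, 27), (1, 2, 1, 17), (1, 9, 1, 19), (8, 16, 1, 769), (1,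
    1, 1, 128)], [(3, 1, 1, 2), (16, 3, 1, 7), (1, 1, 1, 4), (1, 1, 1, 16), (1, 1, 1, 32)], [(3, 1,
    1, 2), (2, 1, 1, 4), (4, 1, 1, 3), (1, 1, 1, 16), (3, 8, 1, 17), (1, 1, 1, 27)]], []),
   (645, [(8, 1, 1, 3), (3, 1, 1, 9), (3, 1, 1, 27), (3, 1, 1, 81), (3, 1, 1, 243), (1, 8, 16,
    17), (1, 1, 1, 5), (5, 5, 1, 41), (2, 3, 15, 241), (1, 1, 1, 31), (1, 27, 1, 6481)], [[(3, 1,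
    1, 2), (8, 2, 1, 3), (1, 1, 1, 4), (1, 1, 1, 8), (1, 1, 1, 16), (1, 2, 1, 5)], [(3, 1, 1, 2),
    (8, 1, 1, 3), (1, 1, 1, 16), (1, 2, 1, 9), (2, 1, 1, 32), (16, 7, 1, 127), (1, 1, 1, 512)],
    [(24, 1, 1, 9), (1, 1, 1, 16)], [(24, 1, 1, 9), (1, 1, 1, 16)], [(24, 1, 1, 9), (1, 1, 1,
    16)]], []),
   (1134, [(8, 1, 1, 3), (3, 1, 1, 9), (3, 1, 1, 27), (3, 1, 1, 81), (1, 8, 16, 17), (1, 1, 1, 5),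
    (1, 9, 27, 109)], [[(3, 1, 1, 2), (10, 5, 1, 31), (1, 1, 1, 4)], [(24, 2, 1, 9), (1, 1, 1, 2)],
    [(3, 1, 1, 2), (2, 1, 1, 4), (2, 1, 1, 8), (2, 1, 1, 3), (1, 4, 1, 5), (3, 1, 1, 27), (1, 2, 1,
    17), (2, 3, 1, 7), (1, 3, 1, 19), (3, 1, 1, 109), (5, 1, 1, 241), (1, 5, 1, 181), (16, 4, 1,
    23041), (1, 1, 1, 256)], [(3, 1, 1, 2), (2, 1, 1, 4), (6, 8, 1, 17), (1, 1, 1, 5), (1, 9, 1,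
    19), (2, 1, 1, 3), (2, 1, 1, 7), (3, 1, 1, 109), (1, 1, 1, 81), (5, 1, 1, 241), (1, 5, 1, 181),
    (16, 4, 1, 23041), (1, 1, 1, 512)]], []),
   (1249, [(8, 1, 1, 3), (3, 1, 1, 9), (3, 1, 1, 27), (3, 1, 1, 81), (3, 1, 1, 243), (1, 8, 16,
    17), (1, 1, 1, 5), (1, 9, 27, 109)], [[(36, 8, 1, 17), (1, 1, 1, 2), (1, 1, 1, 4), (1, 1, 1,
    8), (1, 1, 1, 5)], [(24, 2, 1, 9), (1, 1, 1, 2), (1, 1, 1, 4), (1, 2, 1, 5)], [(72, 2, 1, 27),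
    (1, 1, 1, 2), (1, 1, 1, 4), (1, 1, 1, 8)], [(3, 1, 1, 2), (8, 1, 1, 3), (1, 1, 1, 4), (1, 1, 1,
    8), (1, 1, 1, 9), (2, 1, 1, 32), (16, 7, 1, 127), (1, 1, 1, 64), (1, 1, 1, 128), (1, 1, 1,
    256)], [(3, 1, 1, 2), (16, 3, 1, 7), (1, 1, 1, 4), (1, 1, 1, 8), (1, 1, 1, 32), (1, 1, 1, 9)]],
    []),
   (1294, [(3, 1, 1, 2), (2, 1, 1, 4), (2, 1, 1, 8), (2, 1, 1, 16), (2, 1, 1, 32), (1, 3, 6, 7),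
    (7, 4, 1, 13), (1, 7, 14, 29), (1, 1, 1, 5)], [], [[(3, 1, 1, 2), (24, 1, 1, 27), (5, 1, 8,
    41)], [(24, 1, 1, 9), (1, 1, 1, 2), (1, 1, 1, 4)], [(12, 1, 1, 8)], [(24, 1, 1, 9), (1, 1, 1,
    2), (1, 1, 1, 16)], [(3, 1, 1, 2), (2, 1, 1, 4), (4, 1, 1, 3), (1, 1, 4, 5), (2, 1, 1, 32), (1,
    1, 3, 7), (7, 1, 1, 13), (1, 1, 7, 29), (1, 1, 5, 421), (1, 1, 2, 281), (27, 1, 1, 2269), (1,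
    1, 1, 243), (1, 1, 1, 1009), (5, 1, 1, 6481), (1, 1, 3, 7561), (1, 1, 3, 19441), (2, 1, 1,
    30241), (1, 1, 2, 8641), (1, 1, 3, 45361), (3, 1, 1, 155521), (3, 1, 1, 408241), (1, 1, 3,
    68041), (1, 1, 3, 102061), (9, 1, 3, 52489), (1, 1, 1, 19683)]]),
   (1457, [(3, 1, 1, 2), (2, 1, 1, 4), (4, 1, 1, 3), (1, 4, 4, 5), (3, 2, 4, 17), (5, 5, 1, 41),
    (1, 3, 5, 61), (1, 1, 1, 11)], [[(3, 1, 1, 2), (16, 3, 1, 7), (1, 1, 1, 4), (1, 1, 1, 8), (1,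
    1, 1, 16), (1, 2, 1, 3), (2, 1, 1, 64), (2, 1, 1, 128), (2, 1, 1, 256), (2, 1, 1, 512), (2, 1,
    1, 1024), (2, 1, 1, 2048), (2, 1, 1, 4096), (2, 1, 1, 8192), (2, 1, 1, 16384), (2, 1, 1,
    32768), (2, 1, 1, 65536), (2, 1, 1, 131072), (2, 1, 1, 262144), (2, 1, 1, 524288), (2, 1, 1,
    1048576), (1, 2, 1, 5), (3, 2, 1, 17), (1, 3, 1, 19), (3, 1, 1, 109), (5, 1, 1, 241), (1, 8, 1,
    641), (1, 2, 1, 769), (1, 5, 1, 23041), (1, 2, 1, 15361), (1, 128, 1, 1179649)]], [[(24, 1, 1,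
    9), (1, 1, 1, 2)], [(6, 1, 1, 4), (4, 1, 1, 3), (1, 1, 1, 9), (3, 1, 1, 27), (3, 1, 1, 81), (3,
    1, 1, 243), (3, 1, 1, 729), (3, 1, 1, 2187), (3, 1, 1, 6561), (3, 1, 1, 19683), (3, 1, 1,
    59049), (3, 1, 1, 177147), (3, 1, 1, 531441), (1, 1, 4, 5), (1, 1, 4, 17), (5, 1, 1, 41), (1,
    1, 3, 6481), (1, 1, 5, 271), (2, 1, 1, 241), (1, 1, 3, 1621), (1, 1, 81, 58321)]]),
   (1529, [(24, 1, 1, 9), (3, 1, 1, 27), (3, 1, 1, 81), (1, 8, 16, 17), (1, 1, 1, 5), (5, 5, 1,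
    41), (2, 3, 15, 241), (1, 1, 1, 7), (1, 1, 1, 31), (1, 9, 1, 271)], [[(36, 8, 1, 17), (1, 1, 1,
    2), (1, 1, 1, 4), (1, 1, 1, 8), (1, 1, 1, 5)], [(3, 1, 1, 2), (8, 2, 1, 9), (1, 1, 1, 4), (1,
    1, 1, 8), (2, 1, 1, 32), (2, 1, 1, 64), (2, 1, 1, 128), (2, 1, 1, 256), (2, 1, 1, 512), (2, 1,
    1, 1024), (2, 1, 1, 2048), (2, 1, 1, 4096), (2, 1, 1, 8192), (2, 1, 1, 16384), (2, 1, 1,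
    32768), (2, 1, 1, 65536), (2, 1, 1, 131072), (2, 1, 1, 262144), (2, 1, 1, 524288), (2, 1, 1,
    1048576), (1, 2, 1, 5), (1, 3, 1, 7), (3, 2, 1, 17), (1, 3, 1, 19), (3, 1, 1, 109), (5, 1, 1,
    241), (5, 25, 1, 115201)], [(24, 1, 1, 9), (1, 1, 1, 4), (2, 3, 1, 7)], [(24, 1, 1, 9), (1, 1,
    1, 4), (2, 1, 1, 32), (2, 1, 1, 64), (8, 7, 1, 127), (1, 1, 1, 128)]], []),
   (1681, [(8, 1, 1, 3), (3, 1, 1, 9), (3, 1, 1, 27), (3, 1, 1, 81), (3, 1, 1, 243), (3, 1, 1,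
    729), (1, 8, 16, 17), (1, 1, 1, 5), (5, 5, 1, 41), (1, 1, 15, 31), (1, 81, 1, 6481)], [[(30, 5,
    1, 31), (1, 1, 1, 4)], [(24, 2, 1, 9), (1, 1, 1, 2), (1, 1, 1, 4), (1, 2, 1, 5)], [(72, 2, 1,
    27), (1, 1, 1, 2), (1, 1, 1, 4), (1, 1, 1, 8)], [(3, 1, 1, 2), (8, 1, 1, 3), (1, 1, 1, 4), (1,
    1, 1, 8), (1, 1, 1, 9), (2, 1, 1, 32), (16, 7, 1, 127), (1, 1, 1, 64), (1, 1, 1, 128)], [(36,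
    8, 1, 17), (1, 1, 1, 2), (1, 1, 1, 4), (1, 1, 1, 8), (1, 1, 1, 5)], [(3, 1, 1, 2), (8, 1, 1,
    3), (1, 1, 1, 4), (1, 1, 1, 8), (1, 1, 1, 9), (2, 1, 1, 32), (7, 12, 1, 13), (1, 1, 1, 5), (1,
    1, 1, 7)]], []),
   (1726, [(8, 1, 1, 3), (27, 1, 1, 81), (1, 8, 16, 17), (1, 1, 1, 5), (2, 3, 3, 7)], [[(3, 1, 1,
    2), (2, 1, 1, 4), (2, 1, 1, 8), (1, 4, 1, 5), (4, 1, 1, 32), (1, 1, 1, 3), (1, 3, 1, 7), (5, 2,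
    1, 241), (1, 5, 1, 61), (5, 1, 1, 151), (1, 5, 1, 1201), (3, 1, 1, 1801), (3, 1, 1, 4051), (3,
    1, 1, 8101), (1, 3, 1, 181), (1, 3, 1, 2161), (2, 1, 1, 21601), (1, 2, 1, 14401), (1, 2, 1,
    43201), (2, 1, 1, 4801), (2, 1, 1, 414721), (16, 8, 1, 921601), (1, 1, 1, 4096)], [(24, 2, 1,
    9), (1, 1, 1, 2), (1, 1, 1, 4)], [(72, 2, 1, 27), (1, 1, 1, 2)], [(192, 1, 1, 128), (1, 1, 1,
    3)]], []),
   (3438, [(8, 1, 1, 3), (3, 1, 1, 9), (3, 1, 1, 27), (3, 1, 1, 81), (1, 8, 16, 17), (1, 1, 1, 5),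
    (1, 9, 27, 109)], [[(3, 1, 1, 2), (10, 5, 1, 31), (1, 1, 1, 4)], [(24, 2, 1, 9), (1, 1, 1, 2)],
    [(3, 1, 1, 2), (2, 1, 1, 4), (2, 4, 1, 5), (3, 2, 1, 17), (1, 9, 1, 19), (2, 1, 1, 3), (2, 1,
    1, 7), (5, 1, 1, 241), (1, 5, 1, 181), (1, 3, 1, 2161), (3, 1, 1, 811), (1, 4, 1, 8641), (1, 6,
    1, 103681), (3, 1, 1, 6481), (1, 3, 1, 19441), (3, 1, 1, 9721), (2, 1, 1, 155521), (32, 4, 1,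
    138241), (1, 1, 1, 2048)], [(3, 1, 1, 2), (2, 1, 1, 4), (2, 4, 1, 5), (2, 1, 1, 3), (3, 1, 1,
    27), (3, 1, 1, 81), (1, 2, 1, 17), (2, 3, 1, 7), (1, 3, 1, 109), (5, 1, 1, 241), (1, 5, 1,
    181), (16, 4, 1, 23041), (1, 1, 1, 256)]], []),
   (3765, [(8, 1, 1, 3), (3, 1, 1, 9), (3, 1, 1, 27), (3, 1, 1, 81), (3, 1, 1, 243), (3, 1, 1,
    729), (1, 8, 16, 17), (1, 1, 1, 5), (5, 5, 5, 11), (1, 1, 1, 41), (2, 3, 3, 241), (1, 1, 1,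
    31), (1, 9, 1, 271), (1, 3, 27, 3889)], [[(36, 8, 1, 17), (1, 1, 1, 2), (1, 1, 1, 4), (1, 1, 1,
    8), (1, 1, 1, 5)], [(24, 2, 1, 9), (1, 1, 1, 2), (1, 1, 1, 16)], [(3, 1, 1, 2), (8, 1, 1, 3),
    (1, 1, 1, 16), (2, 1, 1, 32), (2, 1, 1, 64), (2, 1, 1, 128), (2, 1, 1, 256), (2, 1, 1, 512),
    (2, 1, 1, 1024), (2, 1, 1, 2048), (2, 1, 1, 4096), (2, 1, 1, 8192), (2, 1, 1, 16384), (2, 1, 1,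
    32768), (2, 1, 1, 65536), (2, 1, 1, 131072), (2, 1, 1, 262144), (2, 1, 1, 524288), (2, 1, 1,
    1048576), (1, 3, 1, 7), (1, 4, 1, 5), (3, 2, 1, 17), (1, 3, 1, 19), (3, 1, 1, 109), (5, 1, 1,
    241), (5, 25, 1, 115201)], [(3, 1, 1, 2), (16, 3, 1, 7), (1, 1, 1, 4), (1, 1, 1, 8), (1, 1, 1,
    16), (1, 1, 1, 32), (1, 1, 1, 3)], [(3, 1, 1, 2), (10, 10, 1, 11), (1, 1, 1, 4), (1, 1, 1,
    31)], [(3, 1, 1, 2), (16, 3, 1, 7), (1, 1, 1, 4), (1, 1, 1, 8), (1, 1, 1, 16), (1, 1, 1, 32),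
    (1, 1, 1, 3)]], []),
   (4590, [(8, 1, 1, 3), (3, 1, 1, 9), (3, 1, 1, 27), (3, 1, 1, 81), (3, 1, 1, 243), (1, 8, 16,
    17), (1, 1, 1, 5), (5, 5, 1, 41), (2, 3, 15, 241), (1, 1, 1, 31), (1, 27, 1, 6481)], [[(3, 1,
    1, 2), (10, 10, 1, 11), (1, 1, 1, 4), (1, 1, 1, 31)], [(24, 2, 1, 9), (1, 1, 1, 2)], [(3, 1, 1,
    2), (2, 1, 1, 4), (2, 1, 1, 8), (2, 1, 1, 3), (1, 4, 1, 5), (3, 1, 1, 27), (1, 2, 1, 17), (1,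
    9, 1, 19), (2, 1, 1, 7), (3, 1, 1, 109), (5, 1, 1, 241), (1, 5, 1, 181), (1, 3, 1, 2161), (1,
    4, 1, 8641), (1, 6, 1, 103681), (3, 1, 1, 6481), (1, 3, 1, 19441), (3, 1, 1, 9721), (2, 1, 1,
    155521), (32, 4, 1, 138241), (1, 1, 1, 1024)], [(16, 3, 1, 7), (1, 1, 1, 3)], [(3, 1, 1, 2),
    (2, 1, 1, 4), (6, 8, 1, 17), (1, 1, 1, 5), (1, 9, 1, 19), (2, 1, 1, 3), (2, 1, 1, 7), (3, 1, 1,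
    109), (1, 1, 1, 81), (5, 1, 1, 241), (1, 5, 1, 181), (16, 4, 1, 23041), (1, 1, 1, 256)]], []),
   (5177, [(3, 1, 1, 2), (2, 1, 1, 4), (2, 1, 1, 8), (2, 1, 1, 16), (2, 1, 1, 32), (2, 1, 1, 64),
    (2, 1, 1, 128), (1, 3, 6, 7), (7, 4, 1, 13), (1, 1, 2, 5), (1, 32, 4, 769)], [], [[(72, 1, 1,
    27), (1, 1, 1, 2)], [(6, 1, 1, 4), (6, 1, 16, 17), (1, 1, 1, 5)], [(24, 1, 1, 9), (1, 1, 1, 2),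
    (1, 1, 1, 4), (1, 1, 1, 8), (3, 1, 1, 27), (3, 1, 1, 81), (3, 1, 1, 243), (3, 1, 1, 729), (3,
    1, 1, 2187), (3, 1, 1, 6561), (3, 1, 1, 19683), (3, 1, 1, 59049), (3, 1, 1, 177147), (3, 1, 1,
    531441), (1, 1, 4, 5), (1, 1, 4, 17), (5, 1, 1, 41), (1, 1, 3, 6481), (1, 1, 5, 271), (2, 1, 1,
    241), (1, 1, 3, 1621), (4, 1, 27, 139969)], [(24, 1, 1, 9), (1, 1, 1, 2), (1, 1, 1, 4), (1, 1,
    1, 8), (1, 1, 1, 16)], [(3, 1, 1, 2), (28, 1, 3, 13), (1, 1, 1, 4), (1, 1, 1, 8)], [(3, 1, 1,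
    2), (8, 1, 1, 3), (1, 1, 1, 4), (1, 1, 1, 8), (1, 1, 1, 9), (5, 1, 8, 41), (1, 1, 1, 5)], [(3,
    1, 1, 2), (8, 1, 1, 3), (1, 1, 1, 4), (1, 1, 1, 8), (1, 1, 1, 9), (2, 1, 1, 32), (2, 1, 1, 64),
    (2, 1, 1, 128), (1, 1, 4, 5), (1, 1, 3, 7), (27, 1, 7, 2269), (1, 1, 1, 243)]]),
   (6910, [(8, 1, 1, 3), (27, 1, 1, 81), (1, 8, 16, 17), (1, 1, 1, 5), (5, 5, 1, 41)], [[(3, 1, 1,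
    2), (10, 5, 1, 31), (1, 1, 1, 4)], [(24, 2, 1, 9), (1, 1, 1, 2), (1, 1, 1, 4)], [(72, 2, 1,
    27), (1, 1, 1, 2)], [(3, 1, 1, 2), (2, 1, 1, 4), (4, 1, 1, 3), (1, 4, 1, 5), (2, 1, 1, 32), (1,
    3, 1, 7), (7, 1, 1, 13), (1, 7, 1, 29), (1, 5, 1, 421), (5, 1, 1, 71), (1, 2, 1, 241), (2, 1,
    1, 3361), (1, 3, 1, 2521), (1, 3, 1, 2161), (3, 1, 1, 1009), (8, 4, 1, 23041), (1, 1, 1, 512),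
    (16, 4, 1, 286721), (1, 1, 1, 8192)]], []),
   (11617, [(8, 1, 1, 3), (3, 1, 1, 9), (3, 1, 1, 27), (3, 1, 1, 81), (3, 1, 1, 243), (3, 1, 1,
    729), (3, 1, 1, 2187), (1, 8, 16, 17), (1, 1, 1, 5), (5, 5, 1, 41), (1, 3, 5, 61), (2, 1, 3,
    241), (1, 9, 1, 271), (1, 3, 27, 3889)], [[(3, 1, 1, 2), (8, 2, 1, 3), (1, 1, 1, 4), (1, 1, 1,
    8), (1, 1, 1, 16)], [(24, 2, 1, 9), (1, 1, 1, 2), (1, 1, 1, 4), (3, 4, 1, 17)], [(72, 2, 1,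
    27), (1, 1, 1, 2), (1, 1, 1, 4), (1, 1, 1, 8)], [(3, 1, 1, 2), (8, 1, 1, 3), (1, 1, 1, 4), (1,
    1, 1, 8), (1, 1, 1, 9), (2, 1, 1, 32), (2, 1, 1, 64), (2, 1, 1, 128), (2, 1, 1, 256), (2, 1, 1,
    512), (2, 1, 1, 1024), (2, 1, 1, 2048), (2, 1, 1, 4096), (2, 1, 1, 8192), (2, 1, 1, 16384), (2,
    1, 1, 32768), (2, 1, 1, 65536), (2, 1, 1, 131072), (2, 1, 1, 262144), (2, 1, 1, 524288), (2, 1,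
    1, 1048576), (1, 3, 1, 7), (1, 4, 1, 5), (3, 2, 1, 17), (1, 3, 1, 19), (3, 1, 1, 109), (5, 1,
    1, 241), (5, 25, 1, 115201)], [(36, 8, 1, 17), (1, 1, 1, 2), (1, 1, 1, 4), (1, 1, 1, 8), (1, 1,
    1, 5)], [(36, 8, 1, 17), (1, 1, 1, 2), (1, 1, 1, 4), (1, 1, 1, 8), (1, 1, 1, 5)], [(3, 1, 1,
    2), (16, 3, 1, 7), (1, 1, 1, 4), (1, 1, 1, 8), (1, 1, 1, 16), (1, 1, 1, 32)]], []),
   (15541, [(72, 1, 1, 27), (3, 1, 1, 81), (3, 1, 1, 243), (3, 1, 1, 729), (1, 8, 16, 17), (1, 1,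
    1, 5), (5, 5, 1, 41), (2, 3, 15, 241), (1, 1, 1, 31), (1, 9, 1, 271), (1, 3, 27, 3889)], [[(3,
    1, 1, 2), (8, 2, 1, 3), (1, 1, 1, 4), (1, 1, 1, 8), (1, 1, 1, 16), (2, 1, 1, 32), (2, 1, 1,
    64), (2, 1, 1, 128), (2, 1, 1, 256), (2, 1, 1, 512), (2, 1, 1, 1024), (2, 1, 1, 2048), (2, 1,
    1, 4096), (2, 1, 1, 8192), (2, 1, 1, 16384), (2, 1, 1, 32768), (2, 1, 1, 65536), (2, 1, 1,
    131072), (2, 1, 1, 262144), (2, 1, 1, 524288), (2, 1, 1, 1048576), (1, 2, 1, 5), (1, 3, 1, 7),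
    (3, 2, 1, 17), (1, 3, 1, 19), (3, 1, 1, 109), (5, 1, 1, 241), (1, 8, 1, 641), (1, 2, 1, 769),
    (1, 5, 1, 23041), (1, 128, 1, 163841)], [(24, 2, 1, 9), (1, 1, 1, 2), (1, 1, 1, 4), (1, 1, 1,
    8)], [(24, 1, 1, 9), (1, 1, 1, 2), (1, 1, 1, 4), (1, 1, 1, 8), (2, 3, 1, 7), (1, 1, 1, 32)],
    [(24, 1, 1, 9), (1, 1, 1, 2), (1, 1, 1, 4), (1, 1, 1, 8), (3, 8, 1, 17), (1, 1, 1, 5)], [(24,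
    1, 1, 9), (1, 1, 1, 2), (1, 1, 1, 4), (1, 1, 1, 8), (2, 3, 1, 7), (1, 1, 1, 32)], [(24, 1, 1,
    9), (1, 1, 1, 2), (1, 1, 1, 4), (1, 1, 1, 8), (2, 1, 1, 32), (2, 1, 1, 64), (8, 7, 1, 127), (1,
    1, 1, 128)]], []),
   (20734, [(8, 1, 1, 3), (3, 1, 1, 9), (3, 1, 1, 27), (3, 1, 1, 81), (3, 1, 1, 243), (3, 1, 1,
    729), (1, 8, 16, 17), (1, 1, 1, 5), (1, 9, 27, 109)], [[(3, 1, 1, 2), (10, 5, 1, 31)], [(24, 2,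
    1, 9), (1, 1, 1, 2), (1, 1, 1, 4)], [(72, 2, 1, 27), (1, 1, 1, 2)], [(3, 1, 1, 2), (72, 2, 1,
    81)], [(3, 1, 1, 2), (2, 1, 1, 4), (4, 1, 1, 3), (1, 4, 1, 5), (3, 2, 1, 17), (2, 3, 1, 7), (1,
    3, 1, 19), (3, 1, 1, 109), (5, 1, 1, 241), (1, 5, 1, 181), (16, 4, 1, 23041), (1, 1, 1, 512)],
    [(3, 1, 1, 2), (2, 1, 1, 4), (4, 1, 1, 3), (1, 4, 1, 5), (2, 3, 1, 7), (2, 1, 1, 64), (8, 7, 1,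
    127), (2, 1, 1, 1024)]], []),
   (31086, [(8, 1, 1, 3), (3, 1, 1, 9), (3, 1, 1, 27), (3, 1, 1, 81), (3, 1, 1, 243), (3, 1, 1,
    729), (1, 8, 16, 17), (1, 1, 1, 5), (5, 5, 1, 41), (2, 3, 15, 241), (1, 1, 1, 31), (1, 9, 1,
    271), (1, 3, 27, 3889)], [[(3, 1, 1, 2), (10, 5, 1, 31)], [(24, 2, 1, 9), (1, 1, 1, 2)], [(3,
    1, 1, 2), (2, 1, 1, 4), (6, 8, 1, 17), (1, 1, 1, 5), (1, 9, 1, 19), (2, 1, 1, 3), (2, 1, 1, 7),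
    (5, 1, 1, 241), (1, 5, 1, 181), (1, 3, 1, 2161), (3, 1, 1, 811), (1, 4, 1, 8641), (1, 6, 1,
    103681), (3, 1, 1, 6481), (1, 3, 1, 19441), (3, 1, 1, 9721), (2, 1, 1, 155521), (2, 1, 1,
    77761), (2, 1, 1, 414721), (2, 1, 1, 311041), (5, 1, 1, 259201), (1, 5, 1, 172801), (2, 1, 1,
    115201), (56, 2, 1, 286721), (1, 1, 1, 8192)], [(3, 1, 1, 2), (10, 5, 1, 31)], [(3, 1, 1, 2),
    (10, 5, 1, 31), (1, 1, 1, 4)], [(3, 1, 1, 2), (2, 1, 1, 4), (2, 1, 1, 8), (2, 1, 1, 3), (3, 1,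
    1, 27), (3, 1, 1, 81), (3, 1, 1, 243), (1, 4, 1, 5), (3, 1, 1, 729), (1, 2, 1, 17), (2, 3, 1,
    7), (1, 3, 1, 109), (8, 18, 1, 10369), (1, 1, 1, 256)]], []),
   (62206, [(8, 1, 1, 3), (3, 1, 1, 9), (81, 1, 1, 729), (1, 8, 16, 17), (1, 1, 1, 5), (1, 9, 9,
    19)], [[(3, 1, 1, 2), (10, 10, 1, 11), (1, 1, 1, 4), (1, 1, 1, 31)], [(24, 2, 1, 9), (1, 1, 1,
    2), (1, 1, 1, 4)], [(72, 2, 1, 27), (1, 1, 1, 2)], [(3, 1, 1, 2), (72, 2, 1, 81)], [(3, 1, 1,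
    2), (2, 1, 1, 4), (4, 1, 1, 3), (1, 4, 1, 5), (2, 3, 1, 7), (2, 1, 1, 64), (8, 7, 1, 127), (1,
    20, 1, 4481), (1, 8, 1, 769), (8, 16, 1, 12289), (1, 1, 1, 4096)], [(3, 1, 1, 2), (2, 1, 1, 4),
    (4, 1, 1, 3), (1, 4, 1, 5), (3, 2, 1, 17), (2, 3, 1, 7), (1, 3, 1, 19), (3, 1, 1, 109), (5, 1,
    1, 241), (1, 5, 1, 181), (16, 4, 1, 23041), (1, 1, 1, 512)]], []),
   (82942, [(8, 1, 1, 3), (3, 1, 1, 9), (3, 1, 1, 27), (3, 1, 1, 81), (3, 1, 1, 243), (3, 1, 1,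
    729), (3, 1, 1, 2187), (1, 8, 16, 17), (1, 1, 1, 5), (5, 5, 1, 41), (2, 3, 15, 241), (1, 1, 1,
    31), (1, 27, 1, 6481)], [[(3, 1, 1, 2), (12, 8, 1, 17), (1, 1, 1, 4), (1, 1, 1, 5)], [(24, 2,
    1, 9), (1, 1, 1, 2), (1, 1, 1, 4)], [(72, 2, 1, 27), (1, 1, 1, 2)], [(3, 1, 1, 2), (72, 2, 1,
    81)], [(3, 1, 1, 2), (2, 1, 1, 4), (4, 1, 1, 3), (1, 4, 1, 5), (3, 2, 1, 17), (1, 9, 1, 19),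
    (2, 1, 1, 7), (3, 1, 1, 109), (5, 1, 1, 241), (1, 5, 1, 181), (1, 3, 1, 2161), (1, 4, 1, 8641),
    (1, 6, 1, 103681), (3, 1, 1, 6481), (1, 3, 1, 19441), (3, 1, 1, 9721), (2, 1, 1, 155521), (32,
    4, 1, 138241), (1, 1, 1, 2048)], [(3, 1, 1, 2), (16, 3, 1, 7), (1, 1, 1, 4), (1, 1, 1, 32), (1,
    1, 1, 3)], [(3, 1, 1, 2), (2, 1, 1, 4), (4, 1, 1, 3), (1, 4, 1, 5), (2, 1, 1, 32), (1, 3, 1,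
    7), (7, 1, 1, 13), (16, 7, 1, 127), (1, 1, 1, 512)]], []),
   (559870, [(8, 1, 1, 3), (3, 1, 1, 9), (3, 1, 1, 27), (243, 1, 1, 6561), (1, 8, 16, 17), (1, 1,
    1, 5), (5, 5, 1, 41), (1, 3, 5, 61), (1, 1, 1, 11)], [[(3, 1, 1, 2), (10, 5, 1, 31)], [(24, 2,
    1, 9), (1, 1, 1, 2), (1, 1, 1, 4)], [(72, 2, 1, 27), (1, 1, 1, 2)], [(3, 1, 1, 2), (72, 2, 1,
    81)], [(3, 1, 1, 2), (2, 1, 1, 4), (4, 1, 1, 3), (1, 4, 1, 5), (2, 3, 1, 7), (2, 1, 1, 64), (8,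
    7, 1, 127), (1, 20, 1, 4481), (1, 8, 1, 769), (5, 1, 1, 641), (3, 1, 1, 23041), (1, 3, 1,
    2521), (1, 3, 1, 8641), (1, 3, 1, 103681), (2, 2, 1, 15361), (2, 1, 1, 138241), (7, 1, 1,
    241921), (3, 1, 1, 96769), (3, 1, 1, 1451521), (1, 3, 1, 311041), (3, 1, 1, 1088641), (1, 3, 1,
    81649), (3, 1, 1, 466561), (3, 1, 1, 139969), (3, 1, 1, 459271), (1, 3, 1, 21871), (1, 3, 1,
    1102249), (1, 3, 1, 1377811), (3, 1, 1, 196831), (4, 1, 1, 286721), (2, 32, 1, 737281), (1, 1,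
    1, 16384)], [(3, 1, 1, 2), (12, 8, 1, 17), (1, 1, 1, 4), (1, 1, 1, 5)], [(3, 1, 1, 2), (10, 5,
    1, 31)], [(3, 1, 1, 2), (2, 1, 1, 4), (4, 1, 1, 3), (1, 4, 1, 5), (3, 2, 1, 17), (2, 3, 1, 7),
    (1, 3, 1, 19), (3, 1, 1, 109), (5, 1, 1, 241), (1, 5, 1, 181), (16, 4, 1, 23041), (1, 1, 1,
    512)]], [])]

/-! ### Lucas numbers modulo `m` -/

theorem lucasNat_double (h : ℕ) :
    (lucasNat (2 * h) : ℤ) = lucasNat h ^ 2 - 2 * (-1) ^ h ∧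
      (lucasNat (2 * h + 1) : ℤ) = lucasNat h * lucasNat (h + 1) - (-1) ^ h ∧
      (lucasNat (2 * h + 2) : ℤ) = lucasNat (h + 1) ^ 2 + 2 * (-1) ^ h := by
  induction h with
  | zero => decide
  | succ h ih =>
    obtain ⟨h0, h1, h2⟩ := ih
    have hr : ∀ n, (lucasNat (n + 2) : ℤ) = lucasNat (n + 1) + lucasNat n := fun n => by
      rw [lucasNat, Nat.cast_add]
    have h3 : (lucasNat (2 * h + 3) : ℤ) = lucasNat (h + 1) * lucasNat (h + 2) + (-1) ^ h := by
      rw [hr (2 * h + 1), h2, h1, hr h]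
      ring
    refine ⟨?_, ?_, ?_⟩
    · rw [mul_add, h2]
      ring
    · rw [mul_add, h3]
      ring
    · rw [mul_add, hr (2 * h + 2), h3, h2]
      have := hr (2 * h)
      rw [h2, h1, h0] at this
      rw [hr h]
      linear_combination this

/-- `k a b`, where `a` and `b` are congruent modulo `m` to the terms of the Lucas sequence with
indices `n < 2 ^ f` and `n + 1`. -/
def lucasModPair (m f : ℕ) : ℕ → (ℕ → ℕ → ℕ) → ℕ :=
  Nat.rec (fun _ k => k 2 1) (fun _ half n k =>
    Nat.rec (k 2 1) (fun _ _ => half (Nat.div n 2) fun a b =>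
      withValue (Nat.rec (m - 1) (fun _ _ => 1) (Nat.mod (Nat.div n 2) 2)) fun e =>
        withValue (Nat.mod (a * b + e) m) fun w =>
          Nat.rec (withValue (Nat.mod (a * a + 2 * e) m) fun v => k v w)
            (fun _ _ => withValue (Nat.mod (b * b + 2 * (m - e)) m) fun v => k w v)
            (Nat.mod n 2)) n) f

theorem lucasModPair_eq {m f n : ℕ} (hm : 0 < m) (hn : n < 2 ^ f) (k : ℕ → ℕ → ℕ) :
    ∃ a b : ℕ, (a : ZMod m) = lucasNat n ∧ (b : ZMod m) = lucasNat (n + 1) ∧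
      lucasModPair m f n k = k a b := by
  induction f generalizing n k with
  | zero =>
    obtain rfl : n = 0 := by simpa using hn
    exact ⟨2, 1, rfl, rfl, rfl⟩
  | succ f ih =>
    rcases Nat.eq_zero_or_pos n with rfl | hpos
    · exact ⟨2, 1, rfl, rfl, rfl⟩
    set h := n / 2 with hh
    have hdef : lucasModPair m (f + 1) n k = lucasModPair m f h fun a b =>
        withValue (Nat.rec (m - 1) (fun _ _ => 1) (h % 2)) fun e =>
          withValue ((a * b + e) % m) fun w =>
            Nat.rec (withValue ((a * a + 2 * e) % m) fun v => k v w)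
              (fun _ _ => withValue ((b * b + 2 * (m - e)) % m) fun v => k w v) (n % 2) := by
      obtain ⟨n, rfl⟩ := Nat.exists_eq_succ_of_ne_zero hpos.ne'
      rfl
    rw [hdef]
    obtain ⟨a, b, ha, hb, hab⟩ := ih (n := h) (by rw [pow_succ] at hn; omega) _
    rw [hab]
    simp only [withValue_eq]
    have hd := lucasNat_double h
    obtain ⟨e, he, hem, hes⟩ : ∃ e : ℕ, Nat.rec (m - 1) (fun _ _ => 1) (h % 2) = e ∧ e ≤ m ∧
        (e : ZMod m) = -(-1) ^ h := by
      rcases Nat.mod_two_eq_zero_or_one h with h2 | h2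
      · refine ⟨m - 1, by rw [h2]; rfl, by omega, ?_⟩
        rw [Nat.cast_sub hm, (Nat.even_iff.2 h2).neg_one_pow]
        simp
      · refine ⟨1, by rw [h2]; rfl, hm, ?_⟩
        rw [(Nat.odd_iff.2 h2).neg_one_pow]
        simp
    rw [he]
    have hz : ∀ {x y : ℤ}, x = y → (x : ZMod m) = y := fun h => congrArg _ h
    have h0 := hz hd.1
    have h1 := hz hd.2.1
    have h2 := hz hd.2.2
    push_cast at h0 h1 h2
    rcases Nat.mod_two_eq_zero_or_one n with hn2 | hn2
    · refine ⟨(a * a + 2 * e) % m, (a * b + e) % m, ?_, ?_, by rw [hn2]; rfl⟩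
      · rw [show n = 2 * h by omega, h0, ZMod.natCast_mod]
        push_cast
        rw [ha, hes]
        ring
      · rw [show n = 2 * h by omega, h1, ZMod.natCast_mod]
        push_cast
        rw [ha, hb, hes]
        ring
    · refine ⟨(a * b + e) % m, (b * b + 2 * (m - e)) % m, ?_, ?_, by rw [hn2]; rfl⟩
      · rw [show n = 2 * h + 1 by omega, h1, ZMod.natCast_mod]
        push_cast
        rw [ha, hb, hes]
        ring
      · rw [show n = 2 * h + 1 by omega, h2, ZMod.natCast_mod]
        push_cast [hem]
        rw [hb, hes]
        simp
        ring

/-- `L n` modulo `m`, for `n < 2 ^ 24`. -/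
def lucasMod (m n : ℕ) : ℕ := lucasModPair m 24 n fun a _ => a

theorem lucasMod_modEq {m n : ℕ} (hm : 0 < m) (hn : n < 2 ^ 24) :
    lucasMod m n ≡ lucasNat n [MOD m] := by
  obtain ⟨a, b, ha, -, hk⟩ := lucasModPair_eq hm hn fun a _ => a
  rw [lucasMod, hk]
  exact (ZMod.natCast_eq_natCast_iff _ _ _).1 ha

/-- The correctness of the second entry of a row of `moduli`. -/
def periodValid (r : ℕ × ℕ × ℕ × ℕ) : Bool :=
  Nat.blt 0 r.1 && Nat.blt 0 r.2.1 && Nat.blt (r.2.1 + 1) (2 ^ 24) &&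
    Nat.beq (lucasMod r.1 r.2.1 % r.1) (2 % r.1) &&
      Nat.beq (lucasMod r.1 (r.2.1 + 1) % r.1) (1 % r.1)

theorem moduli_valid : moduli.all periodValid = true := by
  decide +kernel

theorem lucasNat_mod_modEq {m p : ℕ} (h0 : lucasNat p ≡ 2 [MOD m])
    (h1 : lucasNat (p + 1) ≡ 1 [MOD m]) (n : ℕ) : lucasNat n ≡ lucasNat (n % p) [MOD m] := by
  have hstep : ∀ n, lucasNat (n + p) ≡ lucasNat n [MOD m] ∧
      lucasNat (n + 1 + p) ≡ lucasNat (n + 1) [MOD m] := by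
    intro n
    induction n with
    | zero => exact ⟨by simpa [lucasNat] using h0, by simpa [lucasNat, add_comm] using h1⟩
    | succ n ih =>
      refine ⟨ih.2, ?_⟩
      rw [show n + 1 + 1 + p = n + p + 2 by ring, lucasNat, lucasNat]
      exact (show n + p + 1 = n + 1 + p by ring) ▸ ih.2.add ih.1
  have hmul : ∀ j, lucasNat (n % p + j * p) ≡ lucasNat (n % p) [MOD m] := by
    intro j
    induction j with
    | zero => simp [Nat.ModEq]
    | succ j ih =>
      rw [Nat.succ_mul, ← add_assoc]
      exact (hstep _).1.trans ih
  conv_lhs => rw [← Nat.mod_add_div' n p]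
  exact hmul _

theorem lucasNat_modEq_lucasMod {r : ℕ × ℕ × ℕ × ℕ} (hr : r ∈ moduli) (n : ℕ) :
    lucasNat n ≡ lucasMod r.1 (n % r.2.1) [MOD r.1] := by
  have hv := List.all_eq_true.1 moduli_valid r hr
  simp only [periodValid, Bool.and_eq_true, Nat.beq_eq, Nat.blt_eq] at hv
  obtain ⟨⟨⟨⟨hm, hp⟩, hlt⟩, h0⟩, h1⟩ := hv
  have h := lucasNat_mod_modEq ((lucasMod_modEq hm (by omega)).symm.trans h0)
    ((lucasMod_modEq hm hlt).symm.trans h1) n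
  exact h.trans (lucasMod_modEq hm ((Nat.mod_lt n hp).trans (by omega))).symm

/-! ### Covering arguments for `L n + C = A * b ^ u * c ^ v` -/

/-- Whether `f i` holds for all `i < q`. -/
def allBelow (q : ℕ) (f : ℕ → Bool) : Bool :=
  Nat.rec true (fun i rest => Bool.rec false rest (f i)) q

theorem of_allBelow {q : ℕ} {f : ℕ → Bool} (h : allBelow q f = true) {i : ℕ} (hi : i < q) :
    f i = true := by
  induction q with
  | zero => omega
  | succ q ih =>
    change Bool.rec false (allBelow q f) (f q) = true at h
    cases hq : f q with
    | false => simp [hq] at h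
    | true =>
      rw [hq] at h
      rcases Nat.lt_succ_iff_lt_or_eq.1 hi with hi | rfl
      · exact ih h hi
      · exact hq

/-- The row of `moduli` with first entry `m`. -/
def modulusRow (m : ℕ) : ℕ × ℕ × ℕ × ℕ :=
  List.rec (0, 0, 0, 0) (fun r _ rest => Bool.rec rest r (Nat.beq r.1 m)) moduli

theorem modulusRow_mem {m : ℕ} (hm : 0 < m) (h : (modulusRow m).1 = m) :
    modulusRow m ∈ moduli := by
  unfold modulusRow at h ⊢
  generalize moduli = l at h ⊢
  induction l with
  | nil => exact absurd h hm.ne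
  | cons r l ih =>
    cases hr : Nat.beq r.1 m with
    | true => simp [hr]
    | false =>
      simp only [hr] at h ⊢
      exact List.mem_cons_of_mem _ (ih h)

/-- Whether the equation `L n + C = A * b ^ u * c ^ v` has no solution with residues `r`, `s`, `t`
modulo `N`, `U`, `V`. A stage `(i, j, k, m)` splits these residues into residues modulo `N * i`,
`U * j` and `V * k`, and considers the equation modulo `m`. -/
def search (C A b c : ℕ) : List (ℕ × ℕ × ℕ × ℕ) → ℕ → ℕ → ℕ → ℕ → ℕ → ℕ → Bool :=
  List.rec (fun _ _ _ _ _ _ => false) fun q _ rest N U V r s t =>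
    withValue q.2.2.2 fun m =>
      withValue (modulusRow m).2.1 fun p =>
      withValue (modulusRow m).2.2.1 fun d =>
      withValue (modulusRow m).2.2.2 fun e =>
      withValue (Nat.mul N q.1) fun N' =>
      withValue (Nat.mul U q.2.1) fun U' =>
      withValue (Nat.mul V q.2.2.1) fun V' =>
        allBelow q.1 fun i => withValue (Nat.add r (Nat.mul N i)) fun r' =>
          withValue (Nat.mod (Nat.add (lucasMod m (Nat.mod r' p)) C) m) fun l =>
            allBelow q.2.1 fun j => withValue (Nat.add s (Nat.mul U j)) fun s' =>
              withValue (Nat.mod (Nat.mul A (Nat.pow b (Nat.mod s' d))) m) fun w =>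
                allBelow q.2.2.1 fun k => withValue (Nat.add t (Nat.mul V k)) fun t' =>
                  Bool.rec true (rest N' U' V' r' s' t')
                    (Nat.beq l (Nat.mod (Nat.mul w (Nat.pow c (Nat.mod t' e))) m))

theorem search_cons {C A b c : ℕ} {q : ℕ × ℕ × ℕ × ℕ} {l : List (ℕ × ℕ × ℕ × ℕ)}
    {N U V r s t : ℕ} : search C A b c (q :: l) N U V r s t =
      let R := modulusRow q.2.2.2
      allBelow q.1 fun i => allBelow q.2.1 fun j => allBelow q.2.2.1 fun k => Bool.rec true
        (search C A b c l (N * q.1) (U * q.2.1) (V * q.2.2.1) (r + N * i) (s + U * j) (t + V * k))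
        (Nat.beq ((lucasMod q.2.2.2 ((r + N * i) % R.2.1) + C) % q.2.2.2)
          (A * b ^ ((s + U * j) % R.2.2.1) % q.2.2.2 * c ^ ((t + V * k) % R.2.2.2) %
            q.2.2.2)) := by
  simp only [search, withValue_eq]
  rfl

/-- The applicability of a list of stages, for given values of `N`, `U` and `V`. -/
def stagesValid (A b c : ℕ) : List (ℕ × ℕ × ℕ × ℕ) → ℕ → ℕ → ℕ → Bool
  | [], _, _, _ => true
  | (i, j, k, m) :: l, N, U, V =>
    let R := modulusRow m
    Nat.blt 0 i && Nat.blt 0 j && Nat.blt 0 k && Nat.blt 0 m && Nat.beq R.1 m &&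
      Nat.beq (N * i % R.2.1) 0 &&
      (Nat.beq b 1 || Nat.beq (A * b ^ R.2.2.1 % m) (A % m) &&
        Nat.beq (A * b ^ (U * j % R.2.2.1) % m) (A % m)) &&
      (Nat.beq c 1 || Nat.beq (A * c ^ R.2.2.2 % m) (A % m) &&
        Nat.beq (A * c ^ (V * k % R.2.2.2) % m) (A % m)) &&
      stagesValid A b c l (N * i) (U * j) (V * k)

theorem mul_pow_mod_modEq {A b d m : ℕ} (h : A * b ^ d ≡ A [MOD m]) (u : ℕ) :
    A * b ^ u ≡ A * b ^ (u % d) [MOD m] := by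
  conv_lhs => rw [← Nat.mod_add_div u d]
  generalize u / d = w
  induction w with
  | zero => rfl
  | succ w ih =>
    calc A * b ^ (u % d + d * (w + 1)) = A * b ^ d * b ^ (u % d + d * w) := by ring
      _ ≡ A * b ^ (u % d + d * w) [MOD m] := h.mul_right _
      _ ≡ _ [MOD m] := ih

theorem mul_pow_modEq {A b d m U : ℕ}
    (h : b = 1 ∨ A * b ^ d % m = A % m ∧ A * b ^ (U % d) % m = A % m) (u : ℕ) :
    A * b ^ u ≡ A * b ^ (u % U % d) [MOD m] := by
  rcases h with rfl | ⟨hd, hU⟩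
  · simp [Nat.ModEq]
  · exact (mul_pow_mod_modEq ((mul_pow_mod_modEq hd U).trans hU) u).trans (mul_pow_mod_modEq hd _)

theorem ne_of_search {C A b c : ℕ} {l : List (ℕ × ℕ × ℕ × ℕ)} {N U V r s t n u v : ℕ}
    (hl : stagesValid A b c l N U V = true) (h : search C A b c l N U V r s t = true)
    (hn : n % N = r) (hu : u % U = s) (hv : v % V = t) :
    lucasNat n + C ≠ A * b ^ u * c ^ v := by
  induction l generalizing N U V r s t with
  | nil => exact absurd h Bool.false_ne_true
  | cons q l ih =>
    intro heq
    obtain ⟨i, j, k, m⟩ := q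
    simp only [stagesValid, Bool.and_eq_true, Bool.or_eq_true, Nat.blt_eq, Nat.beq_eq] at hl
    obtain ⟨⟨⟨⟨⟨⟨⟨⟨hi, hj⟩, hk⟩, hm⟩, hR⟩, hN⟩, hU⟩, hV⟩, hl⟩ := hl
    have hmul : ∀ {x M q ρ : ℕ}, x % M = ρ → x % (M * q) = ρ + M * (x / M % q) := by
      rintro x M q _ rfl
      exact Nat.mod_mul
    have hn' := hmul (q := i) hn
    have hu' := hmul (q := j) hu
    have hv' := hmul (q := k) hv
    rw [search_cons] at h
    have h := of_allBelow (of_allBelow (of_allBelow h (Nat.mod_lt (n / N) hi))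
      (Nat.mod_lt (u / U) hj)) (Nat.mod_lt (v / V) hk)
    dsimp only at h
    have hcong : Nat.beq ((lucasMod m ((r + N * (n / N % i)) % (modulusRow m).2.1) + C) % m)
        (A * b ^ ((s + U * (u / U % j)) % (modulusRow m).2.2.1) % m *
          c ^ ((t + V * (v / V % k)) % (modulusRow m).2.2.2) % m) = true := by
      rw [Nat.beq_eq, ← hn', ← hu', ← hv']
      have hL := lucasNat_modEq_lucasMod (modulusRow_mem hm hR) n
      rw [hR, ← Nat.mod_mod_of_dvd n (Nat.dvd_of_mod_eq_zero hN)] at hL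
      have hb := mul_pow_modEq hU u
      have hc := mul_pow_modEq hV v
      calc _ ≡ lucasNat n + C [MOD m] := (hL.add_right C).symm
        _ = A * b ^ u * c ^ v := heq
        _ = A * c ^ v * b ^ u := by ring
        _ ≡ A * c ^ (v % (V * k) % (modulusRow m).2.2.2) * b ^ u [MOD m] := hc.mul_right _
        _ = A * b ^ u * c ^ (v % (V * k) % (modulusRow m).2.2.2) := by ring
        _ ≡ A * b ^ (u % (U * j) % (modulusRow m).2.2.1) *
            c ^ (v % (V * k) % (modulusRow m).2.2.2) [MOD m] := hb.mul_right _
        _ ≡ _ [MOD m] := (Nat.mod_modEq _ _).symm.mul_right _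
    rw [hcong] at h
    exact ih hl h hn' hu' hv' heq

/-- Whether the given stages show that `L n + C = 2 ^ x * 3 ^ y` has no solution with `x ≥ X` and
`y ≥ Y`, where `x = X` if `b = 1` and `y = Y` if `c = 1`. -/
def caseOk (C X Y b c : ℕ) (l : List (ℕ × ℕ × ℕ × ℕ)) : Bool :=
  withValue (2 ^ X * 3 ^ Y) fun A => stagesValid A b c l 1 1 1 && search C A b c l 1 1 1 0 0 0

theorem ne_of_caseOk {C X Y b c : ℕ} {l : List (ℕ × ℕ × ℕ × ℕ)} (h : caseOk C X Y b c l = true)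
    (n u v : ℕ) : lucasNat n + C ≠ 2 ^ X * 3 ^ Y * b ^ u * c ^ v := by
  rw [caseOk, withValue_eq, Bool.and_eq_true] at h
  exact ne_of_search h.1 h.2 (Nat.mod_one n) (Nat.mod_one u) (Nat.mod_one v)

/-- Whether a row of `certificates` shows that `L n + k = 2 ^ x * 3 ^ y` implies `x < 20` and
`y < 12`. -/
def rowOk (r : ℕ × List (ℕ × ℕ × ℕ × ℕ) × List (List (ℕ × ℕ × ℕ × ℕ)) ×
    List (List (ℕ × ℕ × ℕ × ℕ))) : Bool :=
  caseOk r.1 r.2.2.2.length r.2.2.1.length 2 3 r.2.1 &&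
    allBelow r.2.2.1.length (fun y => caseOk r.1 20 y 2 1 (r.2.2.1.getD y [])) &&
      allBelow r.2.2.2.length (fun x => caseOk r.1 x 12 1 3 (r.2.2.2.getD x [])) &&
        Nat.ble r.2.2.2.length 20 && Nat.ble r.2.2.1.length 12

theorem lt_of_rowOk {r : ℕ × List (ℕ × ℕ × ℕ × ℕ) × List (List (ℕ × ℕ × ℕ × ℕ)) ×
    List (List (ℕ × ℕ × ℕ × ℕ))} (h : rowOk r = true) {n x y : ℕ}
    (heq : lucasNat n + r.1 = 2 ^ x * 3 ^ y) : x < 20 ∧ y < 12 := by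
  simp only [rowOk, Bool.and_eq_true, Nat.ble_eq] at h
  obtain ⟨⟨⟨⟨hfree, hy⟩, hx⟩, hX⟩, hY⟩ := h
  by_cases hyY : y < r.2.2.1.length
  · refine ⟨?_, by omega⟩
    by_contra! hx20
    obtain ⟨u, rfl⟩ := Nat.exists_eq_add_of_le hx20
    exact ne_of_caseOk (of_allBelow hy hyY) n u 0 (by rw [heq]; ring)
  by_cases hxX : x < r.2.2.2.length
  · refine ⟨by omega, ?_⟩
    by_contra! hy12
    obtain ⟨v, rfl⟩ := Nat.exists_eq_add_of_le hy12
    exact ne_of_caseOk (of_allBelow hx hxX) n 0 v (by rw [heq]; ring)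
  obtain ⟨u, rfl⟩ := Nat.exists_eq_add_of_le (not_lt.1 hxX)
  obtain ⟨v, rfl⟩ := Nat.exists_eq_add_of_le (not_lt.1 hyY)
  exact absurd (by rw [heq]; ring) (ne_of_caseOk hfree n u v)

theorem certificates_valid : certificates.all rowOk = true := by
  decide +kernel

theorem negValues_covered : negValues.all (fun k => certificates.any fun r => Nat.beq r.1 k) =
    true := by
  decide +kernel

theorem two_pow_le_lucasNat : ∀ n, 2 ^ n ≤ lucasNat (2 * n + 1)
  | 0 => by decide
  | n + 1 => by
    have h1 := two_pow_le_lucasNat n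
    rw [show 2 * (n + 1) + 1 = 2 * n + 1 + 2 by ring, lucasNat, lucasNat, pow_succ]
    omega

theorem lucasNat_le_succ (n : ℕ) (hn : 0 < n) : lucasNat n ≤ lucasNat (n + 1) := by
  obtain ⟨n, rfl⟩ := Nat.exists_eq_succ_of_ne_zero hn.ne'
  rw [lucasNat]
  exact Nat.le_add_right _ _

theorem lucasNat_add_ne {n k x y : ℕ} (hn : 500 < n) (hk : k ∈ negValues) :
    lucasNat n + k ≠ 2 ^ x * 3 ^ y := by
  intro h
  have hcov := List.all_eq_true.1 negValues_covered k hk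
  simp only [List.any_eq_true, Nat.beq_eq] at hcov
  obtain ⟨r, hr, rfl⟩ := hcov
  obtain ⟨hx, hy⟩ := lt_of_rowOk (List.all_eq_true.1 certificates_valid r hr) h
  have hle : 2 ^ x * 3 ^ y ≤ 2 ^ 20 * 3 ^ 12 :=
    Nat.mul_le_mul (Nat.pow_le_pow_right (by norm_num) hx.le)
      (Nat.pow_le_pow_right (by norm_num) hy.le)
  have hmono : lucasNat (2 * 50 + 1) ≤ lucasNat n :=
    Nat.le_induction le_rfl (fun m hm ih => ih.trans (lucasNat_le_succ m (by omega))) n (by omega)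
  have := two_pow_le_lucasNat 50
  omega

theorem neg_c_mixed_range_bound (c : ℤ) (hc : c < 0)
    (n n₁ n₂ x x₁ x₂ y y₁ y₂ : ℕ)
    (h1 : c = lucas n - 2 ^ x * 3 ^ y) (h2 : c = lucas n₁ - 2 ^ x₁ * 3 ^ y₁)
    (h3 : c = lucas n₂ - 2 ^ x₂ * 3 ^ y₂)
    (hnn : n₁ < n) (hnn' : n₂ < n₁) (hn : 500 < n) (hn₁ : n₁ ≤ 500) :
    n < 1557 ∧ x < 1118 ∧ y < 706 := by
  obtain ⟨k, rfl⟩ : ∃ k : ℕ, c = -k := ⟨c.natAbs, by omega⟩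
  have hnat : ∀ {m a b : ℕ}, (-k : ℤ) = lucas m - 2 ^ a * 3 ^ b →
      lucasNat m + k = 2 ^ a * 3 ^ b := fun {m a b} h => by
    rw [lucas_eq_lucasNat] at h
    zify
    linear_combination -h
  exact absurd (hnat h1)
    (lucasNat_add_ne hn (mem_negValues (by omega) hnn' hn₁ (hnat h2) (hnat h3)))
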